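/- Let u = √3/2 and let A(31,3) be the arrangement of 31 lines in the real projective plane consisting of: the ten lines defined by the linear forms x, x−uz, x+uz, x−2uz, x+2uz, x−4uz, x+4uz, y, y−z, y+z in ℝ[x,y,z]; the images of these ten lines under the rotations by 60° and by 120° about the point (0:0:1); and the line z = 0. Let S be the set of all points of ℙ²(ℝ) lying on at least two lines of A(31,3) (there are 127 such points), and let I = ⋂_{P∈S} I(P) ⊆ ℝ[x,y,z] be the ideal of S. Then the third symbolic power I^(3) = ⋂_{P∈S} I(P)³ is not contained in I². -/

import Mathlib

open MvPolynomial

noncomputable section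

/-- The polynomial ring `ℝ[x,y,z]`, with `x = X 0`, `y = X 1`, `z = X 2`. -/
abbrev PolyR := MvPolynomial (Fin 3) ℝ

/-- `u = √3 / 2`. -/
def u : ℝ := Real.sqrt 3 / 2

/-- The rotation by 60° about `(0:0:1)`. -/
def rotA : Matrix (Fin 3) (Fin 3) ℝ := !![1/2, -u, 0; u, 1/2, 0; 0, 0, 1]

/-- Linear substitution of variables by a matrix `M`:  `(substMat M f)(v) = f(M v)`. -/
def substMat (M : Matrix (Fin 3) (Fin 3) ℝ) : PolyR →ₐ[ℝ] PolyR :=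
  MvPolynomial.aeval fun i => ∑ j, MvPolynomial.C (M i j) * MvPolynomial.X j

/-- The ten initial linear forms of the arrangement `A(31,3)`:
`x`, `x ∓ uz`, `x ∓ 2uz`, `x ∓ 4uz`, `y`, `y ∓ z`. -/
def baseForms313 : Fin 10 → PolyR :=
  ![X 0, X 0 - C u * X 2, X 0 + C u * X 2, X 0 - C (2*u) * X 2, X 0 + C (2*u) * X 2,
    X 0 - C (4*u) * X 2, X 0 + C (4*u) * X 2, X 1, X 1 - X 2, X 1 + X 2]

/-- The 31 linear forms defining the simplicial arrangement `A(31,3)`: the ten initial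
forms, their images under the rotations by 60° and 120° about `(0:0:1)` (the image of a
line `{ℓ = 0}` under a matrix `M` being `{ℓ ∘ M⁻¹ = 0}`), and the line at infinity `z = 0`. -/
def lines313 : Fin 31 → PolyR := fun i =>
  if h : (i : ℕ) < 10 then baseForms313 ⟨i, h⟩
  else if h2 : (i : ℕ) < 20 then substMat rotA⁻¹ (baseForms313 ⟨(i : ℕ) - 10, by omega⟩)
  else if h3 : (i : ℕ) < 30 then substMat (rotA ^ 2)⁻¹ (baseForms313 ⟨(i : ℕ) - 20, by omega⟩)
  else X 2

/-- The real projective plane `ℙ²(ℝ)`. -/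
abbrev P2R := Projectivization ℝ (Fin 3 → ℝ)

open Classical in
/-- The number of lines of `A(31,3)` passing through a point `P ∈ ℙ²(ℝ)`. -/
def mult313 (P : P2R) : ℕ :=
  (Finset.univ.filter fun i => MvPolynomial.eval (Projectivization.rep P) (lines313 i) = 0).card

/-- The set of intersection points of `A(31,3)`: points lying on at least two lines. -/
def S313 : Set P2R := {P | 2 ≤ mult313 P}

/-- The homogeneous vanishing ideal `I(P)` of the projective point spanned by `v`:
polynomials vanishing on the whole line `ℝ·v`. -/
def pointIdeal (v : Fin 3 → ℝ) : Ideal PolyR where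
  carrier := {f | ∀ c : ℝ, MvPolynomial.eval (c • v) f = 0}
  zero_mem' := by intro c; simp
  add_mem' := by intro a b ha hb c; simp [ha c, hb c]
  smul_mem' := by intro a f hf c; simp [smul_eq_mul, hf c]

end

set_option linter.all false
set_option linter.unusedSimpArgs false
/-! ### dense integer forms -/

def evRow {R : Type*} [CommRing R] (y z : R) : ℕ → List ℤ → R
  | _, [] => 0
  | 0, c :: _ => (c : R)
  | n + 1, c :: cs => (c : R) * z ^ (n + 1) + y * evRow y z n cs

def ev {R : Type*} [CommRing R] (x y z : R) : ℕ → List (List ℤ) → R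
  | _, [] => 0
  | 0, r :: _ => evRow y z 0 r
  | n + 1, r :: rs => evRow y z (n + 1) r + x * ev x y z n rs

theorem map_evRow {R S : Type*} [CommRing R] [CommRing S] (φ : R →+* S) (y z : R) :
    ∀ (n : ℕ) (r : List ℤ), φ (evRow y z n r) = evRow (φ y) (φ z) n r
  | _, [] => by simp [evRow]
  | 0, c :: _ => by simp [evRow]
  | n + 1, c :: cs => by simp [evRow, map_evRow φ y z n cs]

theorem map_ev {R S : Type*} [CommRing R] [CommRing S] (φ : R →+* S) (x y z : R) :
    ∀ (n : ℕ) (r : List (List ℤ)), φ (ev x y z n r) = ev (φ x) (φ y) (φ z) n r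
  | _, [] => by simp [ev]
  | 0, c :: _ => by simp [ev, map_evRow]
  | n + 1, c :: cs => by simp [ev, map_evRow, map_ev φ x y z n cs]

theorem evRow_smul {R : Type*} [CommRing R] (t y z : R) :
    ∀ (n : ℕ) (r : List ℤ), evRow (t * y) (t * z) n r = t ^ n * evRow y z n r
  | _, [] => by simp [evRow]
  | 0, c :: _ => by simp [evRow]
  | n + 1, c :: cs => by simp only [evRow, evRow_smul t y z n cs]; ring

theorem ev_smul {R : Type*} [CommRing R] (t x y z : R) :
    ∀ (n : ℕ) (r : List (List ℤ)), ev (t * x) (t * y) (t * z) n r = t ^ n * ev x y z n r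
  | _, [] => by simp [ev]
  | 0, c :: _ => by simp [ev, evRow_smul]
  | n + 1, c :: cs => by simp only [ev, evRow_smul, ev_smul t x y z n cs]; ring

/-- the form as a polynomial -/
noncomputable def pol (n : ℕ) (P : List (List ℤ)) : PolyR := ev (X 0) (X 1) (X 2) n P

theorem eval_pol (v : Fin 3 → ℝ) (n : ℕ) (P : List (List ℤ)) :
    eval v (pol n P) = ev (v 0) (v 1) (v 2) n P := by
  simp [pol, map_ev]

/-! ### the functional -/

noncomputable def LF (T : ℕ → ℕ → ℤ) (D : ℤ) : PolyR →ₗ[ℝ] ℝ :=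
  (MvPolynomial.basisMonomials (Fin 3) ℝ).constr ℝ
    (fun s => if ((s 0 + s 1 + s 2 : ℕ) : ℤ) = D then (T (s 0) (s 1) : ℝ) else 0)

theorem LF_mon (T : ℕ → ℕ → ℤ) (D : ℤ) (s : Fin 3 →₀ ℕ) :
    LF T D (monomial s 1) =
      if ((s 0 + s 1 + s 2 : ℕ) : ℤ) = D then (T (s 0) (s 1) : ℝ) else 0 := by
  have := (MvPolynomial.basisMonomials (Fin 3) ℝ).constr_basis ℝ
    (fun s => if ((s 0 + s 1 + s 2 : ℕ) : ℤ) = D then (T (s 0) (s 1) : ℝ) else 0) s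
  simpa [LF] using this

theorem LF_ext (A B : PolyR →ₗ[ℝ] ℝ) (h : ∀ s, A (monomial s 1) = B (monomial s 1))
    (f : PolyR) : A f = B f := by
  have : A = B := (MvPolynomial.basisMonomials (Fin 3) ℝ).ext (by intro s; simpa using h s)
  rw [this]

theorem LF_congr (T T' : ℕ → ℕ → ℤ) (D : ℤ)
    (h : ∀ i j : ℕ, ((i + j : ℕ) : ℤ) ≤ D → T i j = T' i j) (f : PolyR) :
    LF T D f = LF T' D f := by
  apply LF_ext
  intro s
  rw [LF_mon, LF_mon]
  split_ifs with h1
  · rw [h]; push_cast at h1 ⊢; omega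
  · rfl

theorem LF_X0 (T : ℕ → ℕ → ℤ) (D : ℤ) (f : PolyR) :
    LF T D (X 0 * f) = LF (fun i j => T (i + 1) j) (D - 1) f := by
  refine LF_ext (LF T D ∘ₗ LinearMap.mulLeft ℝ (X 0)) _ ?_ f
  intro s
  simp only [LinearMap.comp_apply, LinearMap.mulLeft_apply, X, monomial_mul, one_mul, LF_mon]
  simp only [Finsupp.add_apply, Finsupp.single_apply]
  simp [add_comm]
  congr 1
  apply propext; omega

theorem LF_X1 (T : ℕ → ℕ → ℤ) (D : ℤ) (f : PolyR) :
    LF T D (X 1 * f) = LF (fun i j => T i (j + 1)) (D - 1) f := by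
  refine LF_ext (LF T D ∘ₗ LinearMap.mulLeft ℝ (X 1)) _ ?_ f
  intro s
  simp only [LinearMap.comp_apply, LinearMap.mulLeft_apply, X, monomial_mul, one_mul, LF_mon]
  simp only [Finsupp.add_apply, Finsupp.single_apply]
  simp [add_comm]
  congr 1
  apply propext; omega

theorem LF_X2 (T : ℕ → ℕ → ℤ) (D : ℤ) (f : PolyR) :
    LF T D (X 2 * f) = LF T (D - 1) f := by
  refine LF_ext (LF T D ∘ₗ LinearMap.mulLeft ℝ (X 2)) _ ?_ f
  intro s
  simp only [LinearMap.comp_apply, LinearMap.mulLeft_apply, X, monomial_mul, one_mul, LF_mon]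
  simp only [Finsupp.add_apply, Finsupp.single_apply]
  simp
  congr 1
  apply propext; omega

theorem LF_X2_pow (T : ℕ → ℕ → ℤ) (n : ℕ) : ∀ (D : ℤ) (f : PolyR),
    LF T D (X 2 ^ n * f) = LF T (D - n) f := by
  induction n with
  | zero => intro D f; simp
  | succ n ih => intro D f; rw [pow_succ', mul_assoc, LF_X2, ih]; congr 2; push_cast; ring

theorem LF_int (T : ℕ → ℕ → ℤ) (D : ℤ) (c : ℤ) (f : PolyR) :
    LF T D ((c : PolyR) * f) = c * LF T D f := by
  rw [← zsmul_eq_mul, map_zsmul, zsmul_eq_mul]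

theorem LF_addmul (T T' : ℕ → ℕ → ℤ) (D : ℤ) (c : ℤ) (f : PolyR) :
    LF (fun i j => T i j + c * T' i j) D f = LF T D f + c * LF T' D f := by
  refine LF_ext _ (LF T D + (c : ℝ) • LF T' D) ?_ f
  intro s
  simp only [LinearMap.add_apply, LinearMap.smul_apply, LF_mon]
  split_ifs <;> simp

/-! ### tables -/

def val (T : List (List ℤ)) (i j : ℕ) : ℤ := (T.getD i []).getD j 0

noncomputable def addS (c : ℤ) (l : List ℤ) : List ℤ → List ℤ :=
  List.rec (motive := fun _ => List ℤ → List ℤ) (fun _ => [])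
    (fun a as ih bs => List.rec (motive := fun _ => List ℤ) (a :: as)
      (fun b bs' _ => Int.add a (Int.mul c b) :: ih bs') bs) l

theorem addS_nil (c : ℤ) (b : List ℤ) : addS c [] b = [] := rfl
theorem addS_cons_nil (c a : ℤ) (as : List ℤ) : addS c (a :: as) [] = a :: as := rfl
theorem addS_cons_cons (c a b : ℤ) (as bs : List ℤ) :
    addS c (a :: as) (b :: bs) = (a + c * b) :: addS c as bs := rfl

noncomputable def addT (c : ℤ) (l : List (List ℤ)) : List (List ℤ) → List (List ℤ) :=
  List.rec (motive := fun _ => List (List ℤ) → List (List ℤ)) (fun _ => [])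
    (fun a as ih bs => List.rec (motive := fun _ => List (List ℤ)) (a :: as)
      (fun b bs' _ => addS c a b :: ih bs') bs) l

theorem addT_nil (c : ℤ) (b : List (List ℤ)) : addT c [] b = [] := rfl
theorem addT_cons_nil (c : ℤ) (a : List ℤ) (as : List (List ℤ)) :
    addT c (a :: as) [] = a :: as := rfl
theorem addT_cons_cons (c : ℤ) (a b : List ℤ) (as bs : List (List ℤ)) :
    addT c (a :: as) (b :: bs) = addS c a b :: addT c as bs := rfl

def Shape : ℕ → List (List ℤ) → Prop
  | 0, _ => True
  | _ + 1, [] => False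
  | m + 1, a :: as => m + 1 ≤ a.length ∧ Shape m as

theorem addS_length (c : ℤ) : ∀ a b : List ℤ, (addS c a b).length = a.length
  | [], _ => by simp [addS_nil, addS_cons_nil, addS_cons_cons]
  | a :: as, [] => by simp [addS_nil, addS_cons_nil, addS_cons_cons]
  | a :: as, b :: bs => by simp [addS_nil, addS_cons_nil, addS_cons_cons, addS_length c as bs]

theorem addS_val (c : ℤ) : ∀ (a b : List ℤ) (j : ℕ), j < a.length →
    (addS c a b).getD j 0 = a.getD j 0 + c * b.getD j 0
  | [], _, j => by simp
  | a :: as, [], j => by simp [addS_nil, addS_cons_nil, addS_cons_cons]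
  | a :: as, b :: bs, 0 => by simp [addS_nil, addS_cons_nil, addS_cons_cons]
  | a :: as, b :: bs, j + 1 => by
    intro h
    simpa [addS_nil, addS_cons_nil, addS_cons_cons] using addS_val c as bs j (by simpa using h)

theorem addT_shape (c : ℤ) : ∀ (m : ℕ) (a b : List (List ℤ)), Shape m a → Shape m (addT c a b)
  | 0, _, _, _ => by simp [Shape]
  | m + 1, [], _, h => by simp [Shape] at h
  | m + 1, a :: as, [], h => by simpa [addT_nil, addT_cons_nil, addT_cons_cons] using h
  | m + 1, a :: as, b :: bs, h => by
    simp only [addT_nil, addT_cons_nil, addT_cons_cons, Shape, addS_length] at h ⊢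
    exact ⟨h.1, addT_shape c m as bs h.2⟩

theorem addT_val (c : ℤ) : ∀ (m : ℕ) (a b : List (List ℤ)) (i j : ℕ), Shape m a → i + j < m →
    val (addT c a b) i j = val a i j + c * val b i j
  | 0, _, _, i, j, _, h => by omega
  | m + 1, [], _, i, j, h, _ => by simp [Shape] at h
  | m + 1, a :: as, [], i, j, h, _ => by simp [addT_nil, addT_cons_nil, addT_cons_cons, val]
  | m + 1, a :: as, b :: bs, 0, j, h, hj => by
    simp only [Shape] at h
    simpa [addT_nil, addT_cons_nil, addT_cons_cons, val] using addS_val c a b j (by omega)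
  | m + 1, a :: as, b :: bs, i + 1, j, h, hj => by
    simp only [Shape] at h
    simpa [addT_nil, addT_cons_nil, addT_cons_cons, val] using addT_val c m as bs i j h.2 (by omega)

theorem val_tail (T : List (List ℤ)) (i j : ℕ) : val T.tail i j = val T (i + 1) j := by
  cases T <;> simp [val]

theorem val_map_tail : ∀ (T : List (List ℤ)) (i j : ℕ),
    val (T.map List.tail) i j = val T i (j + 1)
  | [], i, j => by simp [val]
  | r :: T, 0, j => by cases r <;> simp [val]
  | r :: T, i + 1, j => by simpa [val] using val_map_tail T i j

noncomputable def addT0 (c : ℤ) (acc T : List (List ℤ)) : List (List ℤ) :=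
  bif c == 0 then acc else addT c acc T

noncomputable def conR : ℕ → List ℤ → List (List ℤ) → List (List ℤ) → List (List ℤ)
  | _, [], _, acc => acc
  | 0, c :: _, T, acc => addT0 c acc T
  | n + 1, c :: cs, T, acc => conR n cs (T.map List.tail) (addT0 c acc T)

theorem addT0_shape (c : ℤ) (m : ℕ) (a b : List (List ℤ)) (h : Shape m a) :
    Shape m (addT0 c a b) := by
  unfold addT0
  cases c == 0
  · exact addT_shape c m a b h
  · exact h

noncomputable def con : ℕ → List (List ℤ) → List (List ℤ) → List (List ℤ) → List (List ℤ)
  | _, [], _, acc => acc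
  | 0, r :: _, T, acc => conR 0 r T acc
  | n + 1, r :: rs, T, acc => con n rs T.tail (conR (n + 1) r T acc)

theorem conR_shape (m : ℕ) : ∀ (n : ℕ) (cs : List ℤ) (T acc : List (List ℤ)), Shape m acc →
    Shape m (conR n cs T acc)
  | _, [], _, acc, h => by simpa [conR] using h
  | 0, c :: _, T, acc, h => by simpa [conR] using addT0_shape c m acc T h
  | n + 1, c :: cs, T, acc, h => by
    simpa [conR] using conR_shape m n cs _ _ (addT0_shape c m acc T h)

theorem LF_addT (c : ℤ) (D : ℤ) (T acc : List (List ℤ)) (h : Shape (D + 1).toNat acc)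
    (f : PolyR) : LF (val (addT c acc T)) D f = LF (val acc) D f + c * LF (val T) D f := by
  rw [← LF_addmul]
  apply LF_congr
  intro i j hij
  exact addT_val c _ acc T i j h (by omega)

theorem LF_addT0 (c : ℤ) (D : ℤ) (T acc : List (List ℤ)) (h : Shape (D + 1).toNat acc)
    (f : PolyR) : LF (val (addT0 c acc T)) D f = LF (val acc) D f + c * LF (val T) D f := by
  unfold addT0
  by_cases hc : c = 0
  · simp [hc]
  · have : (c == 0) = false := by simpa using hc
    rw [this]
    exact LF_addT c D T acc h f

theorem conR_spec : ∀ (n : ℕ) (cs : List ℤ) (T acc : List (List ℤ)) (D : ℤ) (f : PolyR),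
    Shape (D - n + 1).toNat acc →
    LF (val (conR n cs T acc)) (D - n) f =
      LF (val acc) (D - n) f + LF (val T) D (evRow (X 1) (X 2) n cs * f)
  | _, [], _, acc, D, f, h => by simp [conR, evRow]
  | 0, c :: _, T, acc, D, f, h => by
    simp only [conR, evRow]
    rw [LF_addT0 _ _ _ _ h, LF_int]; simp
  | n + 1, c :: cs, T, acc, D, f, h => by
    simp only [conR, evRow]
    have e : D - ((n + 1 : ℕ) : ℤ) = (D - 1) - n := by push_cast; ring
    have h' := h
    rw [e] at h'
    rw [e, conR_spec n cs _ _ (D - 1) f (addT0_shape c _ _ _ h'), LF_addT0 _ _ _ _ h', add_mul,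
      map_add, mul_assoc, LF_int, LF_X2_pow, mul_assoc, LF_X1, e, add_assoc]
    congr 2
    apply LF_congr
    intro i j _
    exact val_map_tail T i j

theorem con_spec : ∀ (n : ℕ) (P : List (List ℤ)) (T acc : List (List ℤ)) (D : ℤ) (f : PolyR),
    Shape (D - n + 1).toNat acc →
    LF (val (con n P T acc)) (D - n) f =
      LF (val acc) (D - n) f + LF (val T) D (ev (X 0) (X 1) (X 2) n P * f)
  | _, [], _, acc, D, f, h => by simp [con, ev]
  | 0, r :: _, T, acc, D, f, h => by
    simp only [con, ev]
    rw [conR_spec _ _ _ _ _ _ h]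
  | n + 1, r :: rs, T, acc, D, f, h => by
    simp only [con, ev]
    have e : D - ((n + 1 : ℕ) : ℤ) = (D - 1) - n := by push_cast; ring
    have h' := conR_shape _ (n + 1) r T acc h
    have h2 := conR_spec (n + 1) r T acc D f h
    rw [e] at h' h2 ⊢
    rw [con_spec n rs _ _ (D - 1) f h', h2, add_mul, map_add, mul_assoc (X 0), LF_X0, add_assoc]
    congr 2
    apply LF_congr
    intro i j _
    exact val_tail T i j

def zTri : ℕ → List (List ℤ)
  | 0 => []
  | m + 1 => List.replicate (m + 1) 0 :: zTri m

theorem zTri_shape : ∀ m, Shape m (zTri m)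
  | 0 => by simp [Shape]
  | m + 1 => by simp [zTri, Shape, zTri_shape m]

theorem zTri_val : ∀ m i j, val (zTri m) i j = 0
  | 0, i, j => by simp [val, zTri]
  | m + 1, 0, j => by
    simp only [val, zTri, List.getD_eq_getElem?_getD, List.getElem?_cons_zero, Option.getD_some,
      List.getElem?_replicate]
    split_ifs <;> rfl
  | m + 1, i + 1, j => by simpa [val, zTri] using zTri_val m i j

theorem LF_zero (T : ℕ → ℕ → ℤ) (D : ℤ) (h : ∀ i j, T i j = 0) (f : PolyR) : LF T D f = 0 := by
  refine LF_ext (LF T D) 0 ?_ f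
  intro s
  simp [LF_mon, h]

abbrev DForm := ℕ × List (List ℤ)

noncomputable def conL : List DForm → List (List ℤ) → ℤ → List (List ℤ)
  | [], T, _ => T
  | g :: gs, T, D => conL gs (con g.1 g.2 T (zTri (D - g.1 + 1).toNat)) (D - g.1)

def degL (gs : List DForm) : ℕ := (gs.map Prod.fst).sum

noncomputable def prodG (gs : List DForm) : PolyR := (gs.map fun g => pol g.1 g.2).prod

theorem conL_spec : ∀ (gs : List DForm) (T : List (List ℤ)) (D : ℤ) (f : PolyR),
    LF (val T) D (prodG gs * f) = LF (val (conL gs T D)) (D - degL gs) f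
  | [], T, D, f => by simp [prodG, conL, degL]
  | g :: gs, T, D, f => by
    have h1 := con_spec g.1 g.2 T (zTri (D - g.1 + 1).toNat) D (prodG gs * f) (zTri_shape _)
    rw [LF_zero _ _ (zTri_val _), zero_add, conL_spec gs] at h1
    have e : D - (degL (g :: gs) : ℤ) = D - g.1 - degL gs := by simp [degL]; ring
    rw [conL, e, h1]
    congr 1
    simp [prodG, pol, mul_assoc]

def isZ (T : List (List ℤ)) : Bool := T.all fun r => r.all fun c => c == 0

theorem isZ_val (T : List (List ℤ)) (h : isZ T = true) (i j : ℕ) : val T i j = 0 := by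
  simp only [isZ, List.all_eq_true, beq_iff_eq] at h
  simp only [val, List.getD_eq_getElem?_getD]
  rcases hi : T[i]? with _ | r
  · simp
  · rcases hj : r[j]? with _ | c
    · simp [hj]
    · simpa [hj] using h r (List.mem_of_getElem? hi) c (List.mem_of_getElem? hj)
/-! ### data -/

abbrev Z3 := ℤ × ℤ × ℤ

def lin (l : Z3) : DForm := (1, [[l.2.2, l.2.1], [l.1]])

def phiT : List (List ℤ) :=
  [[0, 0, 0, -60594657324935362206882690333194058195, 0, -217016907338706154411213166679358358400,
  0, -646347213044958041722610683451902460160, 0, -1711350811452220868698869859952934297600, 0,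
  -4094536955183946397997441340799007784960, 0, -8740258880089909915270018660613373296640, 0,
  -15884729530072778492558170449044060504064, 0, -21946627054383556910593380120353203814400, 0,
  -16966068720070143413859294632676874518528, 0, -16636774883119636145522918975078400000], [], [0,
  20198219108311787402294230111064686065, 0, 14467793822580410294080877778623890560, 0,
  10259479572142191138454137832569880320, 0, -32535811722614914261262832443477237760, 0,
  -195170633652848125367360710437447598080, 0, -672052741485498291909871957169808605184, 0,
  -1826022979014842567400133011829132623872, 0, -3930580648356422082979578589820865216512, 0,
  -5461635168870668080012651613476024745984, 0, 554559162770654538184097299169280000], [], [0,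
  14467793822580410294080877778623890560, 0, 10259479572142191138454137832569880320, 0,
  20416478228279392645196914292182179840, 0, 33509607853378113295722845250888990720, 0,
  42994198494611890759435394104726388736, 0, 27726343056662102592211078353799610368, 0,
  -49800476867385027115925017415974387712, 0, -168184064487546349332422144822287007744, 0,
  -58374648712700477703589189386240000], [], [0, 10259479572142191138454137832569880320, 0,
  2765714911314623676376998713629040640, 0, 8100692130464086777602450174407147520, 0,
  16510978495348550660572158872336203776, 0, 27811177776831675113367050308569530368, 0,
  37179010308006432167468158418239356928, 0, 30658158423636424662668272612856037376, 0,
  10730633954540528989630365696000000], [], [0, 8649302683636213332650303906480087040, 0,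
  -368946443840588728437681517753466880, 0, 1798078495757806161203694854341656576, 0,
  4893963410453998006860590446519779328, 0, 8297958190295402345357434285402882048, 0,
  8636077543874248603562510943514525696, 0, -2861502387877474397234764185600000], [], [0,
  8100692130464086777602450174407147520, 0, -1144501504160342738669997949257252864, 0,
  -183040759820750142519368790459809792, 0, 839343638244500647272271535530835968, 0,
  1319217065187715452865722328218075136, 0, 990520057342202675965879910400000], [], [0,
  7683238495594103960951080461539475456, 0, -1033921161542628863035804882999181312, 0,
  -450497443564341507846158870267297792, 0, -17220204720233788037098868534411264, 0,
  -396208022936881070386351964160000], [], [0, 6879351014471715021398941329111646208, 0,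
  -656119753603813647017466611621691392, 0, -220343817125743007265400222021320704, 0,
  143075119393873719861738209280000], [], [0, 5307031406598773756777957991097827328, 0,
  -259575682284040982443071247298330624], [], [0, 2773349930570558619301556600801591296]]

def gp0 : List (List ℤ) :=
  [[], [0, 0, 0, 0, 0, 4100096, 0, -805376, 0, 34320, 0, -728, 0, 5], [], [0, 0, 0, -41000960, 0,
  5637632, 0, -137280, 0, 12012, 0, -117], [], [0, 36900864, 0, 16912896, 0, -1441440, 0, -96096,
  0, 858], [], [0, -21745152, 0, -1235520, 0, 456456, 0, -858], [], [0, 2779920, 0, -296296, 0,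
  -10439], [], [0, -75348, 0, 10335], [], [0, 216]]

def gp1 : List (List ℤ) :=
  [[], [786432, 0, -479232, 0, 0, 0, 6864], [196608, 0, -119808, 0, 0, 0, 1716], [-1388544, 0,
  1251328, 0, -38896, 0, -8580], [-347136, 0, 312832, 0, -9724, 0, -2145], [681984, 0, -944528, 0,
  48620, 0, 1716], [170496, 0, -236132, 0, 12155, 0, 429], [-74064, 0, 174772, 0, -9724], [-18516,
  0, 43693, 0, -2431], [-5916, 0, -2340], [-1479, 0, -585], [108], [27]]

def gp2 : List (List ℤ) :=
  [[0, -3145728, -393216, 1867776, 233472, -483328, -60416, 65664, 8208, -3264, -408, 40, 5],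
  [3145728, -786432, -2064384, 454656, 86016, -49664, 13696, 3056, 1408, -232, -80, -5], [1179648,
  5603328, -36864, 172032, 32256, -551296, -60336, 44320, 5716, -816, -112], [-5406720, 1413120,
  5177344, -582656, -224384, -58064, -49120, 7980, 1712, 112], [-2064384, -7421952, 970752,
  1712512, 147120, -3168, -15116, 4256, 746], [2469888, -1300992, -3819392, 681168, 298016,
  -11764, 3504, -746], [990720, 2975616, -1050000, -590752, 12028, -18128, -112], [-172416,
  424464, 620896, -171004, -58768, 112], [-95616, -282720, 217044, 52152, -10551], [-35616,
  -33876, 13536, 10551], [-10368, 3456, -216], [-864, 216]]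

def gp3 : List (List ℤ) :=
  [[0, 434176, 54272, -360960, -45120, 108416, 13552, -13792, -1724, 648, 81, -8, -1], [24576,
  81920, 17408, -57920, -36448, 8996, 5580, -812, -224, 53, 16, 1], [27648, 124416, 2752, -245952,
  -35300, 82080, 11172, -7944, -1021, 168, 23], [6144, -27072, 103936, 21352, 24884, 12155, -1775,
  -1483, -400, -29], [-42624, -117696, 37384, -17168, -251, 18616, 1837, -1112, -189], [-68256,
  -1932, -137564, -48858, -4563, 3276, 2579, 237], [12780, 11984, -45214, -20104, -1564, 2072,
  635], [44508, 4747, 28739, 6541, -4049, -551], [3249, 720, 9144, 1440, -630], [-6945, -963,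
  1881, 342], [-1053, 0, 162], [-27]]

def gp4 : List (List ℤ) :=
  [[0, 63314780160, 7914347520, -51924504064, -6490563008, 15610814464, 1951351808, -2006179488,
  -250772436, 94448896, 11806112, -1145728, -143216], [0, -8067615744, -19158528, 7065774400,
  71901424, -1861140224, 11276448, 160534236, -11279775, -3273760, 1066544, 143216], [0,
  -4811338752, -603812160, -21157605872, -2635713056, 8347628448, 1044863112, -744743481,
  -94502907, 13840976, 1863440], [0, 1247738304, 80490768, -1689114688, -540603468, 262884744,
  163468482, 27806331, -8337072, -1863440], [0, -9148249104, -1133469792, -1377525300, -239766096,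
  1048253454, 151465242, -33026640, -5170464], [0, 1242206400, 13592076, 458219064, 27306621,
  -212874522, -7676160, 5170464], [0, 1695882708, 213684348, -454675317, -53421087, 7676160], [0,
  -213684348, 0, 53421087]]

def gp5 : List (List ℤ) :=
  [[0, 32768, 4096, -26624, -3328, 7680, 960, -896, -112, 32, 4], [0, 4096, -6656, -4160, 10848,
  2316, -864, -220, -88, -7], [0, -1024, -960, -10944, -12, 4416, 444, -368, -57], [-23040, -3008,
  -42112, -6632, -2968, 181, 1016, 81], [-2880, -4672, -5848, -3088, -757, 704, 215], [18720,
  1756, 14112, 1378, -2088, -173], [2340, 720, 1854, 144, -243], [-3240, -315, 648, 99], [-405, 0,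
  81]]

def gp6 : List (List ℤ) :=
  [[0, -8192, -3072, 24832, 9408, -6384, -2688, 128, 132, 11], [-24576, 94208, 37120, -64640,
  -6160, 4288, 320, 596, 46], [15360, -174336, -83456, 40736, 18576, 3084, 392, -23], [-39168,
  28800, -50592, 39904, 3844, -5032, -100], [25920, 46544, 42240, -22392, -7884, -83], [15792,
  -8864, 2584, 68, -802], [-7440, -1812, 1344, 735], [-1116, 144, 216]]

def gp7 : List (List ℤ) :=
  [[0, 49152, 43008, 6144, -3264, -48, 768, 210, 15], [-49152, -98304, -68608, -24320, 1232, 3256,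
  608, 37], [55296, -30720, -24960, 8544, 1224, -1062, -141], [-21504, 71424, 31840, -3632, -2752,
  -367], [9792, -8496, -1488, 726, 45], [-2352, -3720, 96, 303], [-504, 126, 81], [0, 27]]

def gp8 : List (List ℤ) :=
  [[0, 99840, 37440, -11088, -5328, 1188, 612, 51], [-69120, -165888, -75888, -5544, 6552, 2250,
  162], [123840, -76464, 18840, 16296, -642, -330], [-66960, 131688, 24480, -9684, -1053], [9720,
  -19020, -5976, -645], [-1080, -2934, -2124], [630, -36], [135]]

def gp9 : List (List ℤ) :=
  [[0, -256, -224, 8, 52, 14, 1], [-768, -512, 120, 124, 18, 1], [480, 376, -92, -88, -10], [264,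
  -28, -32, -10], [-120, 42, 9], [-18, 9]]

def bp0 : List (List ℤ) :=
  [[0, -101248, -104080, -29524, -1246, 479, 44], [-91776, -73856, 5972, 8702, 199], [-75888,
  33684, 50154, 3834], [492, 18066, 2686, -1280], [-1788, 6951, -3564], [-357]]

def bp1 : List (List ℤ) :=
  [[0, 46208, 50288, 20812, 3658, 219], [-48768, -25472, 17140, 11350, 1571, 88], [22416, -34060,
  -18974, -1882], [12876, -4166, -4734, -1048], [2916, -801], [219]]

def bp2 : List (List ℤ) :=
  [[0, -10112, -13072, -3828, -302, -1], [-14976, -11392, 1652, 1582, 31], [-7152, -3788, 7866,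
  1242, 88], [204, 2786, 238, -256], [-252, 1575, -792], [-45]]

def bp3 : List (List ℤ) :=
  [[0, 10880, 2480, 220, 130, 15], [4992, 4736, -668, -674, -25], [33360, -12700, -3590, -370],
  [3804, -2190, -358, 56], [-4140, 2115], [-513, 264]]

def bp4 : List (List ℤ) :=
  [[0, -45440, -60880, -24420, -3830, -205], [309120, 255360, -13340, -27690, -685], [37584,
  51364, 27826, 1170], [-420, -62470, -11050, 3840], [-6252, -3781, -3784], [1335], [264]]

def bp5 : List (List ℤ) :=
  [[0, -1280, -1440, -560, -90, -5], [9984, 4800, -3488, -1230, 113], [480, 1392, 306, -93],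
  [-672, -1170, 557, 240, -32], [-120, -118, 16, 32], [-6]]

def bp6 : List (List ℤ) :=
  [[0, 577920, 231120, 61380, 14670, 1185], [-788352, -346752, 290780, 108498, -4703], [1473840,
  -624900, -200010, -20430], [258276, 86238, -91202, -26112, 1232], [-168660, 87885], [-22047, 0,
  5808]]

def bp7 : List (List ℤ) :=
  [[0, 59010944, 63125264, 26030356, 4585894, 275397], [-1674624, -14392448, -4039092, 11275706,
  4160565], [31915248, -44045140, -24128402, -2394886], [11660148, -11064650, -1398074, -679808,
  -508288, 30976], [3158748, -753183], [275397]]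

def bp8 : List (List ℤ) :=
  [[0, -19048576, -24691696, -8120684, -902666, -29523], [28805760, 4936576, -16677300, -3052630,
  1015533], [-11110416, -2366932, 14140510, 1969826], [-3672972, -1181370, 3615198, 644416,
  -260480], [-953316, 2605777, -1324224, 0, 30976], [-90507]]

def steps : List (Z3 × DForm) :=
  [((-1, 0, 4), (14, gp0)), ((1, 1, -8), (13, gp1)), ((1, 0, 4), (12, gp2)), ((-1, 0, 1), (12,
  gp3)), ((1, 0, 1), (12, gp4)), ((-3, 1, -4), (10, gp5)), ((1, -1, 2), (9, gp6)), ((0, -1, -2),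
  (8, gp7)), ((-1, -1, 2), (7, gp8)), ((3, 1, -4), (6, gp9))]

def betas : List ((ℕ × ℕ) × List (List ℤ)) :=
  [((0, 6), bp0), ((1, 5), bp1), ((2, 4), bp2), ((5, 1), bp3), ((6, 0), bp4), ((4, 3), bp5), ((5,
  2), bp6), ((3, 5), bp7), ((4, 4), bp8)]

def hpol : List (List ℤ) :=
  [[2258632704, 0, -1267367936, 0, 201949184, 0, -11955456, 0, 248312, 0, -698, 0, -15], [],
  [-3802103808, 0, 1211695104, 0, -77429376, 0, 2621912, 0, -45736, 0, 698], [], [1817542656, 0,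
  -383136768, 0, 13051016, 0, -203884, 0, -7186], [], [-292627584, 0, 28606856, 0, -117928, 0,
  49328], [], [19039776, 0, 140502, 0, -107271], [], [-487008, 0, -258], [], [3264]]

def lines21 : List Z3 :=
  [(1, 0, -1), (1, 1, -2), (-1, 1, -2), (1, 0, 1), (1, 1, 2), (-1, 1, 2), (1, 0, -4), (1, 1, -8),
  (-1, 1, -8), (1, 0, 4), (1, 1, 8), (-1, 1, 8), (0, 1, 0), (-3, 1, 0), (3, 1, 0), (0, 1, -2),
  (-3, 1, -4), (3, 1, -4), (0, 1, 2), (-3, 1, 4), (3, 1, 4)]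

def pts : List Z3 :=
  [(-10, -2, 1), (-10, 2, 1), (-8, 0, 1), (-6, -14, 1), (-6, -2, 1), (-6, 2, 1), (-6, 14, 1), (-5,
  -3, 1), (-5, 3, 1), (-4, -16, 1), (-4, -12, 1), (-4, -8, 1), (-4, -6, 1), (-4, -4, 1), (-4, -2,
  1), (-4, 0, 1), (-4, 0, 3), (-4, 2, 1), (-4, 4, 1), (-4, 6, 1), (-4, 8, 1), (-4, 12, 1), (-4,
  16, 1), (-3, -5, 1), (-3, -1, 1), (-3, -1, 2), (-3, 1, 1), (-3, 1, 2), (-3, 5, 1), (-2, -10, 1),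
  (-2, -6, 1), (-2, -6, 3), (-2, -4, 1), (-2, -2, 1), (-2, 0, 1), (-2, 2, 1), (-2, 4, 1), (-2, 6,
  1), (-2, 6, 3), (-2, 10, 1), (-1, -9, 1), (-1, -7, 1), (-1, -5, 1), (-1, -5, 2), (-1, -3, 1),
  (-1, -3, 2), (-1, -2, 1), (-1, -1, 1), (-1, 0, 1), (-1, 1, 0), (-1, 1, 1), (-1, 2, 1), (-1, 3,
  0), (-1, 3, 1), (-1, 3, 2), (-1, 5, 1), (-1, 5, 2), (-1, 7, 1), (-1, 9, 1), (0, -8, 1), (0, -4,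
  1), (0, -2, 1), (0, 0, 1), (0, 1, 0), (0, 2, 1), (0, 4, 1), (0, 8, 1), (1, -9, 1), (1, -7, 1),
  (1, -5, 1), (1, -5, 2), (1, -3, 1), (1, -3, 2), (1, -2, 1), (1, -1, 1), (1, 0, 0), (1, 0, 1),
  (1, 1, 0), (1, 1, 1), (1, 2, 1), (1, 3, 0), (1, 3, 1), (1, 3, 2), (1, 5, 1), (1, 5, 2), (1, 7,
  1), (1, 9, 1), (2, -10, 1), (2, -6, 1), (2, -6, 3), (2, -4, 1), (2, -2, 1), (2, 0, 1), (2, 2,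
  1), (2, 4, 1), (2, 6, 1), (2, 6, 3), (2, 10, 1), (3, -5, 1), (3, -1, 1), (3, -1, 2), (3, 1, 1),
  (3, 1, 2), (3, 5, 1), (4, -16, 1), (4, -12, 1), (4, -8, 1), (4, -6, 1), (4, -4, 1), (4, -2, 1),
  (4, 0, 1), (4, 0, 3), (4, 2, 1), (4, 4, 1), (4, 6, 1), (4, 8, 1), (4, 12, 1), (4, 16, 1), (5,
  -3, 1), (5, 3, 1), (6, -14, 1), (6, -2, 1), (6, 2, 1), (6, 14, 1), (8, 0, 1), (10, -2, 1), (10,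
  2, 1)]

def stdB : List (ℕ × ℕ) :=
  [(0, 0), (0, 1), (1, 0), (0, 2), (1, 1), (2, 0), (0, 3), (1, 2), (2, 1), (3, 0), (0, 4), (1, 3),
  (2, 2), (3, 1), (4, 0), (0, 5), (1, 4), (2, 3), (3, 2), (4, 1), (5, 0), (3, 3), (4, 2), (3, 4)]

def gensFrom (bs : List (List DForm)) : List (Z3 × DForm) → List (List DForm)
  | [] => bs
  | s :: ss => [s.2] :: (gensFrom bs ss).map (fun g => lin s.1 :: g)

def betaForms : List (List DForm) := betas.map fun b => [(b.1.1 + b.1.2, b.2)]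

def gens : List (List DForm) := gensFrom betaForms steps

noncomputable def checkFrom : List (List DForm) → Bool
  | [] => true
  | g :: gs => (fun T D => (g :: gs).all fun h => isZ (conL h T D))
      (conL g phiT 33) (33 - degL g) && checkFrom gs

noncomputable def checkPhi : Bool := checkFrom gens
/-! ### points and lines -/

def dot (a b : Z3) : ℤ := a.1 * b.1 + a.2.1 * b.2.1 + a.2.2 * b.2.2

def crs (a b : Z3) : Z3 :=
  (a.2.1 * b.2.2 - a.2.2 * b.2.1, a.2.2 * b.1 - a.1 * b.2.2, a.1 * b.2.1 - a.2.1 * b.1)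

noncomputable def rv (p : Z3) : Fin 3 → ℝ := ![(p.1 : ℝ), (p.2.1 : ℝ), (p.2.2 : ℝ)]

noncomputable def LP (l : Z3) : PolyR := pol 1 (lin l).2

theorem LP_eq (l : Z3) : LP l = (l.1 : PolyR) * X 0 + (l.2.1 : PolyR) * X 1 +
    (l.2.2 : PolyR) * X 2 := by
  simp [LP, pol, lin, ev, evRow]; ring

theorem eval_LP (l : Z3) (v : Fin 3 → ℝ) :
    eval v (LP l) = l.1 * v 0 + l.2.1 * v 1 + l.2.2 * v 2 := by
  simp [LP_eq]

theorem mem_pi {v : Fin 3 → ℝ} {f : PolyR} : f ∈ pointIdeal v ↔ ∀ c : ℝ, eval (c • v) f = 0 :=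
  Iff.rfl

noncomputable def psi (v : Fin 3 → ℝ) : PolyR →ₐ[ℝ] Polynomial ℝ :=
  aeval (fun i => Polynomial.C (v i) * Polynomial.X)

theorem eval_psi (v : Fin 3 → ℝ) (t : ℝ) (f : PolyR) :
    Polynomial.eval t (psi v f) = eval (t • v) f := by
  have : (Polynomial.aeval t).comp (psi v) = aeval (t • v) := by
    ext i; simp only [psi, AlgHom.comp_apply, aeval_X, map_mul, Polynomial.aeval_C, Polynomial.aeval_X, Pi.smul_apply, smul_eq_mul]; exact mul_comm _ _
  have h := DFunLike.congr_fun this f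
  simpa [MvPolynomial.aeval_eq_eval, Polynomial.coe_aeval_eq_eval] using h

theorem mem_pi_psi {v : Fin 3 → ℝ} {f : PolyR} : f ∈ pointIdeal v ↔ psi v f = 0 := by
  rw [mem_pi]
  constructor
  · intro h
    apply Polynomial.funext
    intro t
    rw [eval_psi, h]; simp
  · intro h c
    rw [← eval_psi, h]; simp

theorem pi_prime {v : Fin 3 → ℝ} {f g : PolyR} (h : f * g ∈ pointIdeal v) :
    f ∈ pointIdeal v ∨ g ∈ pointIdeal v := by
  rw [mem_pi_psi, map_mul, mul_eq_zero] at h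
  rwa [mem_pi_psi, mem_pi_psi]

theorem pi_smul {v : Fin 3 → ℝ} {a : ℝ} (ha : a ≠ 0) : pointIdeal (a • v) = pointIdeal v := by
  ext f
  rw [mem_pi, mem_pi]
  constructor
  · intro h c
    have := h (c / a)
    rwa [smul_smul, div_mul_cancel₀ _ ha] at this
  · intro h c
    rw [smul_smul]; exact h _

noncomputable def Ip (p : Z3) : Ideal PolyR := pointIdeal (rv p)

theorem LP_mem {l p : Z3} : LP l ∈ Ip p ↔ dot l p = 0 := by
  rw [Ip, mem_pi]
  have key : ∀ c : ℝ, eval (c • rv p) (LP l) = c * (dot l p : ℤ) := by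
    intro c
    rw [eval_LP]; simp [rv, dot]; ring
  constructor
  · intro h
    have := h 1
    rw [key] at this
    simpa using this
  · intro h c
    rw [key, h]; simp

/-- evaluation over the integers -/
def evRowZ (y z : ℤ) : ℕ → List ℤ → ℤ
  | _, [] => 0
  | 0, c :: _ => c
  | n + 1, c :: cs => c * z ^ (n + 1) + y * evRowZ y z n cs

def evZ (x y z : ℤ) : ℕ → List (List ℤ) → ℤ
  | _, [] => 0
  | 0, r :: _ => evRowZ y z 0 r
  | n + 1, r :: rs => evRowZ y z (n + 1) r + x * evZ x y z n rs

theorem evRowZ_eq (y z : ℤ) : ∀ n r, evRowZ y z n r = evRow y z n r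
  | _, [] => by simp [evRow, evRowZ]
  | 0, c :: _ => by simp [evRow, evRowZ]
  | n + 1, c :: cs => by simp [evRow, evRowZ, evRowZ_eq y z n cs]

theorem evZ_eq (x y z : ℤ) : ∀ n r, evZ x y z n r = ev x y z n r
  | _, [] => by simp [ev, evZ]
  | 0, c :: _ => by simp [ev, evZ, evRowZ_eq]
  | n + 1, c :: cs => by simp [ev, evZ, evRowZ_eq, evZ_eq x y z n cs]

def evp (p : Z3) (g : DForm) : ℤ := evZ p.1 p.2.1 p.2.2 g.1 g.2

theorem eval_pol_rv (p : Z3) (n : ℕ) (P : List (List ℤ)) :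
    eval (rv p) (pol n P) = (evp p (n, P) : ℤ) := by
  rw [eval_pol, evp, evZ_eq]
  have := map_ev (Int.castRingHom ℝ) p.1 p.2.1 p.2.2 n P
  simp only [eq_intCast] at this
  rw [this]; simp [rv]

theorem eval_pol_smul (c : ℝ) (v : Fin 3 → ℝ) (n : ℕ) (P : List (List ℤ)) :
    eval (c • v) (pol n P) = c ^ n * eval v (pol n P) := by
  rw [eval_pol, eval_pol, ← ev_smul]; simp

theorem pol_mem {p : Z3} {n : ℕ} {P : List (List ℤ)} (h : evp p (n, P) = 0) :
    pol n P ∈ Ip p := by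
  rw [Ip, mem_pi]
  intro c
  rw [eval_pol_smul, eval_pol_rv, h]; simp

theorem LP_cross (l p : Z3) (h : dot l p = 0) :
    ((dot l l : ℤ) : PolyR) * ((p.2.1 : PolyR) * X 2 - (p.2.2 : PolyR) * X 1) =
        (l.1 : PolyR) * LP (crs l p) - ((crs l p).1 : PolyR) * LP l ∧
    ((dot l l : ℤ) : PolyR) * ((p.2.2 : PolyR) * X 0 - (p.1 : PolyR) * X 2) =
        (l.2.1 : PolyR) * LP (crs l p) - ((crs l p).2.1 : PolyR) * LP l ∧
    ((dot l l : ℤ) : PolyR) * ((p.1 : PolyR) * X 1 - (p.2.1 : PolyR) * X 0) =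
        (l.2.2 : PolyR) * LP (crs l p) - ((crs l p).2.2 : PolyR) * LP l := by
  have h' : (l.1 : PolyR) * p.1 + l.2.1 * p.2.1 + l.2.2 * p.2.2 = 0 := by
    have := congrArg (Int.cast : ℤ → PolyR) h
    simpa [dot] using this
  simp only [LP_eq, crs, dot]
  push_cast
  refine ⟨?_, ?_, ?_⟩
  · linear_combination ((l.2.1 : PolyR) * X 2 - (l.2.2 : PolyR) * X 1 : PolyR) * h'
  · linear_combination ((l.2.2 : PolyR) * X 0 - (l.1 : PolyR) * X 2 : PolyR) * h'
  · linear_combination ((l.1 : PolyR) * X 1 - (l.2.1 : PolyR) * X 0 : PolyR) * h'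

theorem int_unit {a : ℤ} (ha : a ≠ 0) : IsUnit ((a : ℤ) : PolyR) := by
  have : ((a : ℤ) : PolyR) = C (a : ℝ) := by simp
  rw [this]
  exact (isUnit_iff_ne_zero.mpr (by exact_mod_cast ha)).map C

/-- a vanishing ideal of a point is generated by two linear forms -/
theorem base_mem (l p : Z3) (hl : dot l l ≠ 0) (hp : dot p p ≠ 0) (h : dot l p = 0)
    {f : PolyR} (hf : f ∈ Ip p) : f ∈ Ideal.span {LP l, LP (crs l p)} := by
  set J := Ideal.span {LP l, LP (crs l p)} with hJ
  have h1 : LP l ∈ J := Ideal.subset_span (by simp)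
  have h2 : LP (crs l p) ∈ J := Ideal.subset_span (by simp)
  obtain ⟨c1, c2, c3⟩ := LP_cross l p h
  have hu := int_unit hl
  have d1 : ((p.2.1 : PolyR) * X 2 - (p.2.2 : PolyR) * X 1 : PolyR) ∈ J := by
    rw [← Ideal.unit_mul_mem_iff_mem J hu, c1]
    exact J.sub_mem (J.mul_mem_left _ h2) (J.mul_mem_left _ h1)
  have d2 : ((p.2.2 : PolyR) * X 0 - (p.1 : PolyR) * X 2 : PolyR) ∈ J := by
    rw [← Ideal.unit_mul_mem_iff_mem J hu, c2]
    exact J.sub_mem (J.mul_mem_left _ h2) (J.mul_mem_left _ h1)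
  have d3 : ((p.1 : PolyR) * X 1 - (p.2.1 : PolyR) * X 0 : PolyR) ∈ J := by
    rw [← Ideal.unit_mul_mem_iff_mem J hu, c3]
    exact J.sub_mem (J.mul_mem_left _ h2) (J.mul_mem_left _ h1)
  have key : ∀ i j : Fin 3, (C (rv p i) * X j - C (rv p j) * X i : PolyR) ∈ J := by
    have e1 := J.neg_mem d1
    have e2 := J.neg_mem d2
    have e3 := J.neg_mem d3
    rw [neg_sub] at e1 e2 e3
    intro i j
    fin_cases i <;> fin_cases j <;> simp [rv] <;> assumption
  have hk : ∃ k, rv p k ≠ 0 := by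
    by_contra hcon
    push Not at hcon
    apply hp
    have a0 := hcon 0
    have a1 := hcon 1
    have a2 := hcon 2
    simp [rv] at a0 a1 a2
    simp [dot, a0, a1, a2]
  obtain ⟨k, hk⟩ := hk
  let q := Ideal.Quotient.mkₐ ℝ J
  have hq : q = (Polynomial.aeval ((rv p k)⁻¹ • q (X k))).comp (psi (rv p)) := by
    ext i
    have := key k i
    rw [← Ideal.Quotient.eq_zero_iff_mem] at this
    have h3 : q (C (rv p k) * X i - C (rv p i) * X k) = 0 := this
    rw [map_sub, map_mul, map_mul, sub_eq_zero] at h3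
    have hC : ∀ a : ℝ, q (C a) = algebraMap ℝ _ a := fun a => q.commutes a
    rw [hC, hC, ← Algebra.smul_def, ← Algebra.smul_def] at h3
    simp only [AlgHom.comp_apply, psi, aeval_X, map_mul, Polynomial.aeval_C, Polynomial.aeval_X]
    rw [← Algebra.smul_def, smul_comm, ← h3, smul_smul, inv_mul_cancel₀ hk, one_smul]
  have hz : q f = 0 := by
    rw [hq, AlgHom.comp_apply, mem_pi_psi.mp hf, map_zero]
  exact Ideal.Quotient.eq_zero_iff_mem.mp hz

noncomputable def PiL (l : Z3) (on : List Z3) : PolyR := (on.map fun p => LP (crs l p)).prod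

theorem line_mem (l : Z3) (hl : dot l l ≠ 0) {f : PolyR} : ∀ (on : List Z3),
    (∀ p ∈ on, dot p p ≠ 0 ∧ dot l p = 0) →
    on.Pairwise (fun p p' => dot (crs l p') p ≠ 0) → (∀ p ∈ on, f ∈ Ip p) →
    ∃ a b, f = a * LP l + b * PiL l on
  | [], _, _, _ => ⟨0, f, by simp [PiL]⟩
  | p :: on, h1, h2, h3 => by
    rw [List.pairwise_cons] at h2
    obtain ⟨a, b, hab⟩ := line_mem l hl on (fun p hp => h1 p (by simp [hp])) h2.2
      (fun p hp => h3 p (by simp [hp]))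
    obtain ⟨hpp, hlp⟩ := h1 p (by simp)
    have hf := h3 p (by simp)
    have hbP : b * PiL l on ∈ Ip p := by
      have : b * PiL l on = f - a * LP l := by rw [hab]; ring
      rw [this]
      exact (Ip p).sub_mem hf ((Ip p).mul_mem_left _ (LP_mem.mpr hlp))
    have hno : ∀ on' : List Z3, (∀ p' ∈ on', dot (crs l p') p ≠ 0) → PiL l on' ∉ Ip p := by
      intro on'
      induction on' with
      | nil =>
        intro _ hh
        have := (mem_pi.mp hh) 1
        simp [PiL] at this
      | cons q on' ih =>
        intro hq hh
        simp only [PiL, List.map_cons, List.prod_cons] at hh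
        rcases pi_prime hh with hh | hh
        · exact hq q (by simp) (LP_mem.mp hh)
        · exact ih (fun p' hp' => hq p' (by simp [hp'])) hh
    have hb : b ∈ Ip p := (pi_prime hbP).resolve_right (hno on h2.1)
    have := base_mem l p hl hpp hlp hb
    rw [Ideal.mem_span_pair] at this
    obtain ⟨a', b', hb'⟩ := this
    refine ⟨a + a' * PiL l on, b', ?_⟩
    rw [hab, ← hb']
    simp only [PiL, List.map_cons, List.prod_cons]
    ring
/-! ### peeling -/

theorem hc_mul {φ : PolyR} {m : ℕ} (h : φ.IsHomogeneous m) (k : ℕ) (ψ : PolyR) :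
    homogeneousComponent (k + m) (ψ * φ) = homogeneousComponent k ψ * φ := by
  induction ψ using MvPolynomial.induction_on' with
  | monomial s c =>
    have h1 : (monomial s c : PolyR).IsHomogeneous s.degree := isHomogeneous_monomial c rfl
    rw [homogeneousComponent_of_mem (h1.mul h), homogeneousComponent_of_mem h1]
    by_cases hk : k = s.degree <;> simp [hk]
  | add p q hp hq => rw [add_mul, map_add, map_add, add_mul, hp, hq]

theorem int_homog (c : ℤ) : ((c : ℤ) : PolyR).IsHomogeneous 0 := by
  have : ((c : ℤ) : PolyR) = C (c : ℝ) := by simp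
  rw [this]; exact isHomogeneous_C _ _

theorem evRow_homog : ∀ (n : ℕ) (r : List ℤ),
    (evRow (X 1 : PolyR) (X 2) n r).IsHomogeneous n
  | _, [] => by simpa [evRow] using isHomogeneous_zero _ _ _
  | 0, c :: _ => by simpa only [evRow] using int_homog c
  | n + 1, c :: cs => by
    simp only [evRow]
    apply IsHomogeneous.add
    · simpa using (int_homog c).mul ((isHomogeneous_X ℝ (2 : Fin 3)).pow (n + 1))
    · simpa [add_comm] using (isHomogeneous_X ℝ (1 : Fin 3)).mul (evRow_homog n cs)

theorem pol_homog : ∀ (n : ℕ) (r : List (List ℤ)), (pol n r).IsHomogeneous n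
  | _, [] => by simpa [pol, ev] using isHomogeneous_zero _ _ _
  | 0, c :: _ => by simpa only [pol, ev] using evRow_homog 0 c
  | n + 1, c :: cs => by
    simp only [pol, ev]
    apply IsHomogeneous.add
    · exact evRow_homog _ _
    · simpa [add_comm, pol] using (isHomogeneous_X ℝ (0 : Fin 3)).mul (pol_homog n cs)

theorem PiL_homog (l : Z3) : ∀ on : List Z3, (PiL l on).IsHomogeneous on.length
  | [] => by simpa [PiL] using isHomogeneous_one _ _
  | p :: on => by
    simpa [PiL, LP, add_comm] using (pol_homog 1 (lin (crs l p)).2).mul (PiL_homog l on)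

def IS (S : List Z3) (f : PolyR) : Prop := ∀ p ∈ S, f ∈ Ip p

def probe (l : Z3) : Z3 := crs l (17, 29, 101)

def stepOK (S : List Z3) (l : Z3) (g : DForm) : Prop :=
  dot l l ≠ 0 ∧ dot l (probe l) = 0 ∧ evp (probe l) g ≠ 0 ∧ (∀ p ∈ S, evp p g = 0) ∧
  (∀ p ∈ S, dot p p ≠ 0) ∧ g.1 ≠ 0 ∧ (S.filter fun p => dot l p == 0).length = g.1 ∧
  (S.filter fun p => dot l p == 0).Pairwise (fun p p' => dot (crs l p') p ≠ 0)

instance (S : List Z3) (l : Z3) (g : DForm) : Decidable (stepOK S l g) := by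
  unfold stepOK; infer_instance

theorem peel {S : List Z3} {l : Z3} {g : DForm} (h : stepOK S l g) {f : PolyR} (hf : IS S f) :
    ∃ c q, f = c * pol g.1 g.2 + LP l * q ∧ IS (S.filter fun p => !(dot l p == 0)) q := by
  obtain ⟨hl, hv, hgv, hg, hS, hn, hlen, hpw⟩ := h
  set on := S.filter fun p => dot l p == 0 with hon
  have hon' : ∀ p ∈ on, p ∈ S ∧ dot l p = 0 := by
    intro p hp
    simpa [hon] using hp
  have hgI : ∀ p ∈ S, pol g.1 g.2 ∈ Ip p := fun p hp => pol_mem (hg p hp)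
  have h1 : ∀ p ∈ on, dot p p ≠ 0 ∧ dot l p = 0 :=
    fun p hp => ⟨hS p (hon' p hp).1, (hon' p hp).2⟩
  obtain ⟨a, b, hab⟩ := line_mem l hl on h1 hpw (fun p hp => hf p (hon' p hp).1)
  obtain ⟨a', b', hab'⟩ := line_mem l hl on h1 hpw (fun p hp => hgI p (hon' p hp).1)
  obtain ⟨n, hn'⟩ := Nat.exists_eq_succ_of_ne_zero hn
  have hcg := congrArg (homogeneousComponent g.1) hab'
  rw [homogeneousComponent_eq_self (pol_homog _ _), map_add] at hcg
  have e1 : homogeneousComponent g.1 (a' * LP l) = homogeneousComponent n a' * LP l := by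
    rw [hn']; exact hc_mul (pol_homog 1 (lin l).2) n a'
  have e2 : homogeneousComponent g.1 (b' * PiL l on) = C (coeff 0 b') * PiL l on := by
    have := hc_mul (PiL_homog l on) 0 b'
    rwa [zero_add, hlen, homogeneousComponent_zero] at this
  rw [e1, e2] at hcg
  have hb0 : coeff 0 b' ≠ 0 := by
    intro h0
    have hh := congrArg (eval (rv (probe l))) hcg
    have hm := (mem_pi.mp (LP_mem.mpr hv)) 1
    rw [one_smul] at hm
    rw [eval_pol_rv, h0, map_add, map_mul, hm] at hh
    simp at hh
    exact hgv hh
  have hPi : PiL l on = C (coeff 0 b')⁻¹ * pol g.1 g.2 -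
      C (coeff 0 b')⁻¹ * homogeneousComponent n a' * LP l := by
    rw [hcg]
    have : (C (coeff 0 b')⁻¹ * C (coeff 0 b') : PolyR) = 1 := by
      rw [← C_mul, inv_mul_cancel₀ hb0, C_1]
    linear_combination (-PiL l on) * this
  refine ⟨b * C (coeff 0 b')⁻¹,
    a - b * (C (coeff 0 b')⁻¹ * homogeneousComponent n a'), ?_, ?_⟩
  · rw [hab, hPi]; ring
  · intro p hp
    have hp' : p ∈ S ∧ dot l p ≠ 0 := by simpa using hp
    set q := a - b * (C (coeff 0 b')⁻¹ * homogeneousComponent n a')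
    have : LP l * q = f - b * C (coeff 0 b')⁻¹ * pol g.1 g.2 := by
      rw [hab, hPi]; ring
    have hm : LP l * q ∈ Ip p := by
      rw [this]
      exact (Ip p).sub_mem (hf p hp'.1) ((Ip p).mul_mem_left _ (hgI p hp'.1))
    exact (pi_prime hm).resolve_left (fun hh => hp'.2 (LP_mem.mp hh))

def resid : List Z3 → List (Z3 × DForm) → List Z3
  | S, [] => S
  | S, s :: ss => resid (S.filter fun p => !(dot s.1 p == 0)) ss

def chainOK : List Z3 → List (Z3 × DForm) → Bool
  | _, [] => true
  | S, s :: ss => decide (stepOK S s.1 s.2) &&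
      chainOK (S.filter fun p => !(dot s.1 p == 0)) ss

noncomputable def GS (gs : List (List DForm)) : Ideal PolyR := Ideal.span {f | ∃ g ∈ gs, f = prodG g}

theorem GS_lin (l : Z3) (gs : List (List DForm)) {q : PolyR} (hq : q ∈ GS gs) :
    LP l * q ∈ GS (gs.map fun g => lin l :: g) := by
  refine Submodule.span_induction (p := fun q _ => LP l * q ∈ GS (gs.map fun g => lin l :: g))
    ?_ ?_ ?_ ?_ hq
  · rintro _ ⟨g, hg, rfl⟩
    refine Ideal.subset_span ⟨lin l :: g, List.mem_map.mpr ⟨g, hg, rfl⟩, ?_⟩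
    simp [prodG, LP, lin]
  · simp
  · intro x y _ _ hx hy
    rw [mul_add]; exact Ideal.add_mem _ hx hy
  · intro a x _ hx
    rw [smul_eq_mul, mul_left_comm]; exact Ideal.mul_mem_left _ _ hx

theorem GS_mono {gs gs' : List (List DForm)} (h : ∀ g ∈ gs, g ∈ gs') : GS gs ≤ GS gs' := by
  apply Ideal.span_mono
  rintro _ ⟨g, hg, rfl⟩
  exact ⟨g, h g hg, rfl⟩

theorem chain_mem (bs : List (List DForm)) : ∀ (ss : List (Z3 × DForm)) (S : List Z3),
    chainOK S ss = true → (∀ f, IS (resid S ss) f → f ∈ GS bs) →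
    ∀ f, IS S f → f ∈ GS (gensFrom bs ss)
  | [], S, _, h, f, hf => h f hf
  | s :: ss, S, hc, h, f, hf => by
    simp only [chainOK, Bool.and_eq_true, decide_eq_true_eq] at hc
    obtain ⟨c, q, hfq, hq⟩ := peel hc.1 hf
    have := chain_mem bs ss _ hc.2 h q hq
    rw [hfq, gensFrom]
    apply Ideal.add_mem
    · apply Ideal.mul_mem_left
      exact Ideal.subset_span ⟨[s.2], by simp, by simp [prodG]⟩
    · exact GS_mono (by intro g hg; exact List.mem_cons_of_mem _ hg) (GS_lin s.1 _ this)

theorem chain_ok : chainOK pts steps = true := by decide +kernel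
def rpts : List Z3 :=
  [(-10, 2, 1), (-8, 0, 1), (-6, 2, 1), (-5, 3, 1), (-3, 1, 1), (-2, -10, 1), (-2, -6, 1), (-2,
  -4, 1), (-2, 2, 1), (-2, 6, 1), (-1, -5, 2), (-1, -3, 2), (0, -8, 1), (0, -4, 1), (0, 0, 1), (1,
  -5, 2), (1, -3, 2), (2, -10, 1), (2, -6, 1), (2, -4, 1), (2, 2, 1), (3, 1, 1), (6, 14, 1), (10,
  2, 1)]

def invT : List (List ℤ) :=
  [[0, 0, 0, 0, 0, 0, 0, 0, 0, 0, 0, 0, 0, 0, 1, 0, 0, 0, 0, 0, 0, 0, 0, 0], [5, 5, -1, -2, -1, 1,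
  1, -5, -3, 5, 0, -6, 0, 0, -4, -2, -3, -1, 3, -3, 3, -1, 4, -2], [-2, -3, -3, -3, 2, 1, 1, 6,
  -2, 0, 0, 2, -5, -1, -2, -3, 0, 4, 3, 4, 3, 5, -5, -5], [4, 1, -3, -3, 1, -2, 1, -1, 1, 6, 5,
  -5, 1, 1, 5, 2, 6, -2, -2, -1, -5, 2, -2, 1], [1, 4, -5, 1, 3, 0, -6, 1, 6, 2, 6, -1, 2, 5, 2,
  -5, -1, 5, 5, 3, -5, -1, -6, -6], [6, 6, 2, -5, 3, -1, 0, -6, 6, 4, -1, -5, 6, 4, 4, -6, -4, -2,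
  -3, -5, 1, 0, -5, 5], [-3, -2, -1, 6, -1, 0, 5, 6, -6, -6, 4, 3, -2, 5, 3, -3, -6, 1, -4, 5, 1,
  6, -3, -1], [-6, -5, -6, -1, 5, 4, 4, -4, -5, 6, -5, -3, -5, 5, -1, 4, 4, -4, -6, -1, 5, 6, -3,
  -1], [1, 1, 1, -3, 4, -2, -6, -4, -5, -3, 3, -2, -4, 6, 0, 0, -4, 3, -6, 4, 3, -2, 2, 4], [0, 3,
  -4, -6, 0, 1, 1, -1, -4, -1, -1, -4, -6, 6, -6, 6, 5, 5, -2, -4, -5, 0, -1, -3], [-2, 5, 0, -2,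
  2, 2, -6, 3, -1, 6, 4, 5, 2, -3, -2, 2, -5, -2, 0, -6, 2, -3, 5, -1], [5, 4, -1, 2, 1, -2, -1,
  -4, -2, -4, -5, -5, -2, -1, -4, 3, -1, -3, 6, 5, 4, 1, 3, 3], [-1, 4, -2, 1, -3, 3, -4, -5, -3,
  -5, 4, -4, -5, 0, -5, 5, 1, -4, -2, 2, -5, 3, 2, 2], [4, -6, -4, 5, 2, -5, -4, 0, 4, 2, 2, -2,
  6, -6, 5, -3, -5, -3, -5, -4, -5, 5, 1, 5], [-6, -2, -6, 6, -3, -4, -2, 6, 6, 2, 0, 1, -4, -3,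
  6, 6, 5, -6, -5, -5, 2, 3, 5, -5], [1, 0, 2, 0, 5, 6, -5, 5, 0, 2, -1, -6, -2, -2, 3, -1, -6, 2,
  3, -4, -6, -5, 2, 4], [-4, 3, 4, 5, -6, 6, -2, -5, -4, -5, -1, 2, -6, -5, -4, 0, 0, 6, -6, -3,
  -6, 0, 4, 4], [0, -3, -6, -4, 5, 4, -3, 1, -5, 6, -1, -5, 6, -2, 2, -5, 1, -5, -2, -3, 6, -1, 4,
  6], [4, 5, 3, 2, 4, -3, 2, 6, -2, -5, -3, 0, -2, -5, 1, 3, -6, 4, 3, 4, 5, -1, 6, -4], [3, 1,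
  -4, -3, 6, 5, 1, 6, -4, 5, 2, -4, 3, 3, 0, -1, -6, -6, -6, 4, 6, -1, -3, 5], [-6, 0, -2, 0, -6,
  -2, 3, 1, -2, 2, 4, -2, 1, -2, -2, 4, -2, -6, -2, 5, -3, -3, 2, 4], [3, -6, -5, -5, -4, -5, 3,
  6, 0, -3, -5, -1, -6, 2, 0, -5, -5, 6, 6, -6, 2, -2, 2, 6], [5, 0, 0, 0, 5, 2, -2, -3, -4, 0, 5,
  2, 1, 6, 2, 5, 2, 2, -2, -3, -4, 5, 0, 5], [-4, -5, -4, 5, 4, 3, -4, -2, 2, 5, -1, 1, -5, -1, 6,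
  5, -3, 5, -3, 6, 1, -1, -5, 1]]

/-! ### the residual points -/

theorem resid_eq : resid pts steps = rpts := by decide +kernel

theorem evRow_sum {R : Type*} [CommRing R] (y z : R) : ∀ (n : ℕ) (r : List ℤ),
    evRow y z n r = ∑ j ∈ Finset.range (n + 1), ((r.getD j 0 : ℤ) : R) * (y ^ j * z ^ (n - j))
  | n, [] => by simp [evRow]
  | 0, c :: _ => by simp [evRow]
  | n + 1, c :: cs => by
    rw [evRow, Finset.sum_range_succ', evRow_sum y z n cs, Finset.mul_sum, add_comm]
    simp only [List.getD_cons_succ, List.getD_cons_zero, pow_zero, one_mul, Nat.sub_zero,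
      Nat.add_sub_add_right]
    congr 1
    apply Finset.sum_congr rfl
    intro j _
    ring

theorem ev_sum {R : Type*} [CommRing R] (x y z : R) : ∀ (n : ℕ) (P : List (List ℤ)),
    ev x y z n P = ∑ i ∈ Finset.range (n + 1), x ^ i * evRow y z (n - i) (P.getD i [])
  | n, [] => by simp [ev, evRow]
  | 0, c :: _ => by simp [ev]
  | n + 1, c :: cs => by
    rw [ev, Finset.sum_range_succ', ev_sum x y z n cs, Finset.mul_sum, add_comm]
    simp only [List.getD_cons_succ, List.getD_cons_zero, pow_zero, one_mul, Nat.sub_zero,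
      Nat.add_sub_add_right]
    congr 1
    apply Finset.sum_congr rfl
    intro j _
    ring

theorem pol_sum (n : ℕ) (P : List (List ℤ)) : pol n P =
    ∑ s ∈ (Finset.range (n + 1)).sigma (fun i => Finset.range (n - i + 1)),
      ((val P s.1 s.2 : ℤ) : ℝ) • (X 2 ^ (n - s.1 - s.2) * (X 0 ^ s.1 * X 1 ^ s.2) : PolyR) := by
  rw [pol, ev_sum, Finset.sum_sigma]
  apply Finset.sum_congr rfl
  intro i _
  rw [evRow_sum, Finset.mul_sum]
  apply Finset.sum_congr rfl
  intro j _
  rw [MvPolynomial.smul_eq_C_mul]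
  simp only [val, map_intCast]
  ring

noncomputable def sm (k : Fin 24) : PolyR :=
  X 0 ^ (stdB.getD k (0, 0)).1 * X 1 ^ (stdB.getD k (0, 0)).2

noncomputable def LamZ (α : Fin 24 → Polynomial ℝ) : PolyR :=
  ∑ k, Polynomial.aeval (X 2 : PolyR) (α k) * sm k

def inW (f : PolyR) : Prop := ∃ α, f - LamZ α ∈ GS betaForms

theorem LamZ_add (α β : Fin 24 → Polynomial ℝ) : LamZ (α + β) = LamZ α + LamZ β := by
  simp [LamZ, add_mul, Finset.sum_add_distrib]

theorem LamZ_mul (a : Polynomial ℝ) (β : Fin 24 → Polynomial ℝ) :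
    LamZ (fun k => a * β k) = Polynomial.aeval (X 2 : PolyR) a * LamZ β := by
  simp [LamZ, Finset.mul_sum, mul_assoc]

theorem inW_of_mem {f : PolyR} (h : f ∈ GS betaForms) : inW f :=
  ⟨0, by simpa [LamZ] using h⟩

theorem inW_add {f g : PolyR} (hf : inW f) (hg : inW g) : inW (f + g) := by
  obtain ⟨α, hα⟩ := hf
  obtain ⟨β, hβ⟩ := hg
  refine ⟨α + β, ?_⟩
  rw [LamZ_add, add_sub_add_comm]
  exact Ideal.add_mem _ hα hβ

theorem inW_z (a : Polynomial ℝ) {f : PolyR} (hf : inW f) :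
    inW (Polynomial.aeval (X 2 : PolyR) a * f) := by
  obtain ⟨α, hα⟩ := hf
  refine ⟨fun k => a * α k, ?_⟩
  rw [LamZ_mul, ← mul_sub]
  exact Ideal.mul_mem_left _ _ hα

theorem inW_X2 {f : PolyR} (hf : inW f) : inW (X 2 * f) := by
  simpa using inW_z Polynomial.X hf

theorem inW_X2_pow (n : ℕ) {f : PolyR} (hf : inW f) : inW (X 2 ^ n * f) := by
  simpa using inW_z (Polynomial.X ^ n) hf

theorem inW_smul (c : ℝ) {f : PolyR} (hf : inW f) : inW (c • f) := by
  have := inW_z (Polynomial.C c) hf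
  rwa [Polynomial.aeval_C, ← Algebra.smul_def] at this

theorem inW_zero : inW 0 := inW_of_mem (Ideal.zero_mem _)

theorem inW_smul_or {c : ℝ} {f : PolyR} (h : c = 0 ∨ inW f) : inW (c • f) := by
  rcases h with rfl | h
  · rw [zero_smul]; exact inW_zero
  · exact inW_smul c h

theorem inW_sum {ι : Type*} (s : Finset ι) (f : ι → PolyR) (h : ∀ i ∈ s, inW (f i)) :
    inW (∑ i ∈ s, f i) := by
  classical
  induction s using Finset.induction_on with
  | empty => simpa using inW_zero
  | insert a s ha ih =>
    rw [Finset.sum_insert ha]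
    exact inW_add (h _ (by simp)) (ih (fun i hi => h i (by simp [hi])))

theorem inW_sm (k : Fin 24) : inW (sm k) := by
  refine ⟨fun j => if j = k then 1 else 0, ?_⟩
  have : LamZ (fun j => if j = k then 1 else 0) = sm k := by
    rw [LamZ, Finset.sum_eq_single k]
    · simp
    · intro b _ hb; simp [hb]
    · simp
  rw [this, sub_self]; exact Ideal.zero_mem _

theorem std_idx : ∀ b ∈ stdB, ∃ k : Fin 24, stdB.getD k (0, 0) = b := by decide +kernel

theorem inW_std {i j : ℕ} (h : (i, j) ∈ stdB) : inW (X 0 ^ i * X 1 ^ j : PolyR) := by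
  obtain ⟨k, hk⟩ := std_idx _ h
  have := inW_sm k
  rwa [sm, hk] at this

def betaOK (b : (ℕ × ℕ) × List (List ℤ)) : Prop :=
  val b.2 b.1.1 b.1.2 ≠ 0 ∧ ∀ i < b.1.1 + b.1.2 + 1, ∀ j < b.1.1 + b.1.2 - i + 1,
    (i, j) = b.1 ∨ (i, j) ∈ stdB ∨ val b.2 i j = 0

instance (b : (ℕ × ℕ) × List (List ℤ)) : Decidable (betaOK b) := by
  unfold betaOK; infer_instance

theorem betas_ok : ∀ b ∈ betas, betaOK b := by decide +kernel

theorem inW_border {b : (ℕ × ℕ) × List (List ℤ)} (hb : b ∈ betas) :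
    inW (X 0 ^ b.1.1 * X 1 ^ b.1.2 : PolyR) := by
  obtain ⟨h0, h1⟩ := betas_ok b hb
  set n := b.1.1 + b.1.2 with hn
  have hmem : pol n b.2 ∈ GS betaForms :=
    Ideal.subset_span ⟨[(n, b.2)], List.mem_map.mpr ⟨b, hb, rfl⟩, by simp [prodG]⟩
  have hs := pol_sum n b.2
  rw [← Finset.add_sum_erase _ _ (a := (⟨b.1.1, b.1.2⟩ : (_ : ℕ) × ℕ)) (by simp; omega)] at hs
  simp only at hs
  have hz : n - b.1.1 - b.1.2 = 0 := by omega
  rw [hz, pow_zero, one_mul] at hs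
  have hc : ((val b.2 b.1.1 b.1.2 : ℤ) : ℝ) ≠ 0 := by exact_mod_cast h0
  set rest := ∑ s ∈ (((Finset.range (n + 1)).sigma (fun i => Finset.range (n - i + 1))).erase
    (⟨b.1.1, b.1.2⟩ : (_ : ℕ) × ℕ)), ((val b.2 s.1 s.2 : ℤ) : ℝ) •
      (X 2 ^ (n - s.1 - s.2) * (X 0 ^ s.1 * X 1 ^ s.2) : PolyR) with hrest
  have hr : inW rest := by
    apply inW_sum
    rintro ⟨i, j⟩ hij
    rw [Finset.mem_erase, Finset.mem_sigma, Finset.mem_range, Finset.mem_range] at hij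
    obtain ⟨hne, hi, hj⟩ := hij
    apply inW_smul_or
    rcases h1 i hi j hj with h | h | h
    · exfalso; apply hne; rw [← h]
    · right; exact inW_X2_pow _ (inW_std h)
    · left; exact_mod_cast h
  have key : (X 0 ^ b.1.1 * X 1 ^ b.1.2 : PolyR) =
      ((val b.2 b.1.1 b.1.2 : ℤ) : ℝ)⁻¹ • (pol n b.2 + (-1 : ℝ) • rest) := by
    rw [hs, neg_one_smul, add_neg_cancel_right, smul_smul, inv_mul_cancel₀ hc, one_smul]
  rw [key]
  exact inW_smul _ (inW_add (inW_of_mem hmem) (inW_smul _ hr))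

theorem border_ok : ∀ k : Fin 24,
    (((stdB.getD k (0, 0)).1 + 1, (stdB.getD k (0, 0)).2) ∈ stdB ∨
      ((stdB.getD k (0, 0)).1 + 1, (stdB.getD k (0, 0)).2) ∈ betas.map Prod.fst) ∧
    (((stdB.getD k (0, 0)).1, (stdB.getD k (0, 0)).2 + 1) ∈ stdB ∨
      ((stdB.getD k (0, 0)).1, (stdB.getD k (0, 0)).2 + 1) ∈ betas.map Prod.fst) := by
  decide +kernel

theorem inW_cases {i j : ℕ} (h : (i, j) ∈ stdB ∨ (i, j) ∈ betas.map Prod.fst) :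
    inW (X 0 ^ i * X 1 ^ j : PolyR) := by
  rcases h with h | h
  · exact inW_std h
  · obtain ⟨b, hb, he⟩ := List.mem_map.mp h
    have := inW_border hb
    rwa [he] at this

theorem inW_X0 {f : PolyR} (hf : inW f) : inW (X 0 * f) := by
  obtain ⟨α, hα⟩ := hf
  have : X 0 * f = X 0 * (f - LamZ α) +
      ∑ k, Polynomial.aeval (X 2 : PolyR) (α k) * (X 0 * sm k) := by
    rw [mul_sub, LamZ, Finset.mul_sum]
    simp only [mul_left_comm (X 0 : PolyR)]; ring
  rw [this]
  refine inW_add (inW_of_mem (Ideal.mul_mem_left _ _ hα)) (inW_sum _ _ ?_)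
  intro k _
  apply inW_z
  rw [sm, ← mul_assoc, ← pow_succ']
  exact inW_cases (border_ok k).1

theorem inW_X1 {f : PolyR} (hf : inW f) : inW (X 1 * f) := by
  obtain ⟨α, hα⟩ := hf
  have : X 1 * f = X 1 * (f - LamZ α) +
      ∑ k, Polynomial.aeval (X 2 : PolyR) (α k) * (X 1 * sm k) := by
    rw [mul_sub, LamZ, Finset.mul_sum]
    simp only [mul_left_comm (X 1 : PolyR)]; ring
  rw [this]
  refine inW_add (inW_of_mem (Ideal.mul_mem_left _ _ hα)) (inW_sum _ _ ?_)
  intro k _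
  apply inW_z
  rw [sm, mul_left_comm, ← pow_succ']
  exact inW_cases (border_ok k).2

theorem inW_all (f : PolyR) : inW f := by
  induction f using MvPolynomial.induction_on with
  | C a =>
    have := inW_smul a (inW_std (i := 0) (j := 0) (by decide +kernel))
    simpa [MvPolynomial.smul_eq_C_mul] using this
  | add p q hp hq => exact inW_add hp hq
  | mul_X p i hp =>
    rw [mul_comm]
    fin_cases i
    · exact inW_X0 hp
    · exact inW_X1 hp
    · exact inW_X2 hp

def rp (i : Fin 24) : Z3 := rpts.getD i (0, 0, 0)

def MM : Matrix (Fin 24) (Fin 24) ℤ := fun i k =>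
  (rp i).1 ^ (stdB.getD k (0, 0)).1 * (rp i).2.1 ^ (stdB.getD k (0, 0)).2 *
    (rp i).2.2 ^ (7 - (stdB.getD k (0, 0)).1 - (stdB.getD k (0, 0)).2)

def NN : Matrix (Fin 24) (Fin 24) ℤ := fun i k => val invT i k

theorem MN : ∀ i k : Fin 24, (13 : ℤ) ∣ (∑ j, MM i j * NN j k) - (if i = k then 1 else 0) := by
  decide +kernel

theorem MM_det : (MM.map (Int.cast : ℤ → ℝ)).det ≠ 0 := by
  have h1 : MM.map (Int.castRingHom (ZMod 13)) * NN.map (Int.castRingHom (ZMod 13)) = 1 := by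
    ext i k
    rw [← Matrix.map_mul, Matrix.map_apply, Matrix.mul_apply]
    have := (ZMod.intCast_zmod_eq_zero_iff_dvd _ 13).mpr (MN i k)
    rw [Int.cast_sub, sub_eq_zero] at this
    rw [eq_intCast, this, Matrix.one_apply]
    split_ifs <;> simp
  have h2 := congrArg Matrix.det h1
  haveI : Fact (Nat.Prime 13) := ⟨by norm_num⟩
  rw [Matrix.det_mul, Matrix.det_one] at h2
  have h3 : MM.det ≠ 0 := by
    intro h0
    have : (MM.map (Int.castRingHom (ZMod 13))).det = 0 := by
      have := (Int.castRingHom (ZMod 13)).map_det MM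
      rw [h0, map_zero] at this
      exact this.symm
    rw [this, zero_mul] at h2
    exact zero_ne_one h2
  have h4 := (Int.castRingHom ℝ).map_det MM
  have h5 : (MM.map (Int.cast : ℤ → ℝ)).det = (MM.det : ℝ) := h4.symm
  rw [h5]
  exact_mod_cast h3

theorem rp_ok : ∀ i : Fin 24, rp i ∈ rpts ∧ (rp i).2.2 ≠ 0 := by decide +kernel

theorem std_deg : ∀ k : Fin 24, (stdB.getD k (0, 0)).1 + (stdB.getD k (0, 0)).2 ≤ 7 := by
  decide +kernel

theorem beta_vanish : ∀ b ∈ betas, ∀ p ∈ rpts, evp p (b.1.1 + b.1.2, b.2) = 0 := by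
  decide +kernel

theorem GS_beta_vanish {p : Z3} (hp : p ∈ rpts) : GS betaForms ≤ Ip p := by
  rw [GS, Ideal.span_le]
  rintro _ ⟨g, hg, rfl⟩
  obtain ⟨b, hb, rfl⟩ := List.mem_map.mp hg
  have := pol_mem (beta_vanish b hb p hp)
  simpa [prodG] using this

theorem resid_mem (f : PolyR) (hf : IS rpts f) : f ∈ GS betaForms := by
  obtain ⟨α, hα⟩ := inW_all f
  suffices h : α = 0 by
    simpa [h, LamZ] using hα
  have hL : ∀ p ∈ rpts, LamZ α ∈ Ip p := by
    intro p hp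
    have := (Ip p).sub_mem (hf p hp) (GS_beta_vanish hp hα)
    simpa using this
  have hev : ∀ t : ℝ, t ≠ 0 → ∀ k, (α k).eval t = 0 := by
    intro t ht
    have hv : (MM.map (Int.cast : ℤ → ℝ)).mulVec
        (fun k => (α k).eval t * t ^ ((stdB.getD k (0, 0)).1 + (stdB.getD k (0, 0)).2)) = 0 := by
      funext i
      obtain ⟨hi, hz⟩ := rp_ok i
      have hz' : ((rp i).2.2 : ℝ) ≠ 0 := by exact_mod_cast hz
      have h1 := (mem_pi.mp (hL _ hi)) (t / (rp i).2.2)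
      have h2 := congrArg (fun w => w * ((rp i).2.2 : ℝ) ^ 7) h1
      simp only [zero_mul, LamZ, map_sum, map_mul, Finset.sum_mul] at h2
      rw [Matrix.mulVec, dotProduct, Pi.zero_apply, ← h2]
      apply Finset.sum_congr rfl
      intro k _
      have hd := std_deg k
      have e : ∀ a : Polynomial ℝ, eval ((t / ((rp i).2.2 : ℝ)) • rv (rp i))
          (Polynomial.aeval (X 2 : PolyR) a) = a.eval t := by
        intro a
        have := Polynomial.hom_eval₂ a (algebraMap ℝ PolyR)
          (eval ((t / ((rp i).2.2 : ℝ)) • rv (rp i))) (X 2)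
        rw [← Polynomial.aeval_def] at this
        rw [this, Polynomial.eval]
        congr 1
        · ext r; simp [MvPolynomial.algebraMap_eq]
        · simp [rv, div_mul_cancel₀ _ hz']
      rw [e, sm]
      simp only [map_mul, map_pow, eval_X, Matrix.map_apply, MM]
      set a := (stdB.getD k (0, 0)).1
      set b := (stdB.getD k (0, 0)).2
      have e7 : ((rp i).2.2 : ℝ) ^ 7 = ((rp i).2.2 : ℝ) ^ a * ((rp i).2.2 : ℝ) ^ b *
          ((rp i).2.2 : ℝ) ^ (7 - a - b) := by
        rw [← pow_add, ← pow_add]; congr 1; omega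
      rw [e7]
      simp only [rv, Pi.smul_apply, smul_eq_mul, Matrix.cons_val_zero, Matrix.cons_val_one]
      push_cast
      rw [mul_pow, mul_pow, div_pow, div_pow, pow_add]
      field_simp
    have := Matrix.eq_zero_of_mulVec_eq_zero MM_det hv
    intro k
    have h3 := congrFun this k
    simp only [Pi.zero_apply, mul_eq_zero, pow_eq_zero_iff', ht, false_and, or_false] at h3
    exact h3
  funext k
  apply Polynomial.eq_of_infinite_eval_eq
  refine Set.Infinite.mono (s := {t : ℝ | t ≠ 0}) ?_ ?_
  · intro t ht
    simp [hev t ht k]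
  · have : {t : ℝ | t ≠ 0} = ({0} : Set ℝ)ᶜ := by ext; simp
    rw [this]
    exact (Set.finite_singleton 0).infinite_compl

theorem I_le (f : PolyR) (hf : IS pts f) : f ∈ GS gens :=
  chain_mem betaForms steps pts chain_ok (by rw [resid_eq]; exact resid_mem) f hf
/-! ### the functional kills the square of the ideal -/

theorem checkFrom_spec : ∀ (gs : List (List DForm)), checkFrom gs = true →
    ∀ g ∈ gs, ∀ h ∈ gs, ∀ f, LF (val phiT) 33 (prodG g * (prodG h * f)) = 0
  | [], _, g, hg, _, _, _ => by simp at hg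
  | a :: gs, hc, g, hg, h, hh, f => by
    unfold checkFrom at hc
    rw [Bool.and_eq_true] at hc
    obtain ⟨h1, h2⟩ := hc
    simp only [List.all_eq_true] at h1
    have key : ∀ h ∈ a :: gs, ∀ f, LF (val phiT) 33 (prodG a * (prodG h * f)) = 0 := by
      intro h hh f
      rw [conL_spec, conL_spec]
      exact LF_zero _ _ (isZ_val _ (h1 h hh)) _
    rcases List.mem_cons.mp hg with rfl | hg'
    · exact key h hh f
    · rcases List.mem_cons.mp hh with rfl | hh'
      · rw [mul_left_comm]; exact key g hg f
      · exact checkFrom_spec gs h2 g hg' h hh' f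

theorem checkPhi_true : checkPhi = true := by decide +kernel

open Pointwise in
theorem phi_kills {F : PolyR} (hF : F ∈ GS gens ^ 2) : LF (val phiT) 33 F = 0 := by
  rw [pow_two] at hF
  unfold GS at hF
  rw [Ideal.span_mul_span'] at hF
  rw [← Ideal.submodule_span_eq] at hF
  have : ∀ a ∈ ({f | ∃ g ∈ gens, f = prodG g} * {f | ∃ g ∈ gens, f = prodG g} : Set PolyR),
      ∀ f, LF (val phiT) 33 (a * f) = 0 := by
    rintro a ha f
    obtain ⟨x, ⟨g, hg, rfl⟩, y, ⟨h, hh, rfl⟩, rfl⟩ := Set.mem_mul.mp ha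
    rw [mul_assoc]
    exact checkFrom_spec gens checkPhi_true g hg h hh f
  have main : ∀ f, LF (val phiT) 33 (F * f) = 0 := by
    induction hF using Submodule.span_induction with
    | mem x h => exact this x h
    | zero => intro f; simp
    | add x y _ _ hx hy => intro f; rw [add_mul, map_add, hx, hy, add_zero]
    | smul a x _ hx => intro f; rw [smul_eq_mul, mul_comm a, mul_assoc]; exact hx _
  simpa using main 1

noncomputable def FF : PolyR := prodG (lines21.map lin ++ [(12, hpol)])

theorem phiF_ne : val (conL (lines21.map lin ++ [(12,hpol)]) phiT 33) 0 0 ≠ 0 := by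
  decide +kernel

theorem FF_deg : degL (lines21.map lin ++ [(12,hpol)]) = 33 := by decide +kernel

theorem FF_not_mem : FF ∉ GS gens ^ 2 := by
  intro h
  have h1 := phi_kills h
  have h2 := conL_spec (lines21.map lin ++ [(12,hpol)]) phiT 33 1
  rw [mul_one] at h2
  rw [FF, h2, FF_deg] at h1
  have h3 : (1 : PolyR) = monomial 0 1 := rfl
  rw [h3, LF_mon] at h1
  simp at h1
  exact phiF_ne h1
/-! ### vanishing to order three -/

def evRowD {R : Type*} [CommRing R] (y z : R) : ℕ → List ℤ → R
  | _, [] => 0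
  | 0, _ :: _ => 0
  | n + 1, _ :: cs => evRow y z n cs + y * evRowD y z n cs

def evDx {R : Type*} [CommRing R] (x y z : R) : ℕ → List (List ℤ) → R
  | _, [] => 0
  | 0, _ :: _ => 0
  | n + 1, _ :: rs => ev x y z n rs + x * evDx x y z n rs

def evDy {R : Type*} [CommRing R] (x y z : R) : ℕ → List (List ℤ) → R
  | _, [] => 0
  | 0, _ :: _ => 0
  | n + 1, r :: rs => evRowD y z (n + 1) r + x * evDy x y z n rs

theorem map_evRowD {R S : Type*} [CommRing R] [CommRing S] (φ : R →+* S) (y z : R) :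
    ∀ (n : ℕ) (r : List ℤ), φ (evRowD y z n r) = evRowD (φ y) (φ z) n r
  | _, [] => by simp [evRowD]
  | 0, c :: _ => by simp [evRowD]
  | n + 1, c :: cs => by simp [evRowD, map_evRow, map_evRowD φ y z n cs]

theorem map_evDx {R S : Type*} [CommRing R] [CommRing S] (φ : R →+* S) (x y z : R) :
    ∀ (n : ℕ) (r : List (List ℤ)), φ (evDx x y z n r) = evDx (φ x) (φ y) (φ z) n r
  | _, [] => by simp [evDx]
  | 0, c :: _ => by simp [evDx]
  | n + 1, c :: cs => by simp [evDx, map_ev, map_evDx φ x y z n cs]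

theorem map_evDy {R S : Type*} [CommRing R] [CommRing S] (φ : R →+* S) (x y z : R) :
    ∀ (n : ℕ) (r : List (List ℤ)), φ (evDy x y z n r) = evDy (φ x) (φ y) (φ z) n r
  | _, [] => by simp [evDy]
  | 0, c :: _ => by simp [evDy]
  | n + 1, c :: cs => by simp [evDy, map_evRowD, map_evDy φ x y z n cs]

theorem evRowD_smul {R : Type*} [CommRing R] (t y z : R) :
    ∀ (n : ℕ) (r : List ℤ), t * evRowD (t * y) (t * z) n r = t ^ n * evRowD y z n r
  | _, [] => by simp [evRowD]
  | 0, c :: _ => by simp [evRowD]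
  | n + 1, c :: cs => by
    simp only [evRowD, evRow_smul]
    linear_combination (t * y) * evRowD_smul t y z n cs

theorem evDx_smul {R : Type*} [CommRing R] (t x y z : R) :
    ∀ (n : ℕ) (r : List (List ℤ)), t * evDx (t * x) (t * y) (t * z) n r = t ^ n * evDx x y z n r
  | _, [] => by simp [evDx]
  | 0, c :: _ => by simp [evDx]
  | n + 1, c :: cs => by
    simp only [evDx, ev_smul]
    linear_combination (t * x) * evDx_smul t x y z n cs

theorem evDy_smul {R : Type*} [CommRing R] (t x y z : R) :
    ∀ (n : ℕ) (r : List (List ℤ)), t * evDy (t * x) (t * y) (t * z) n r = t ^ n * evDy x y z n r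
  | _, [] => by simp [evDy]
  | 0, c :: _ => by simp [evDy]
  | n + 1, c :: cs => by
    simp only [evDy]
    linear_combination (t * x) * evDy_smul t x y z n cs + evRowD_smul t y z (n + 1) c

theorem evRow_taylor {R : Type*} [CommRing R] (y z B : R) (J : Ideal R) (hB : B * B ∈ J) :
    ∀ (n : ℕ) (r : List ℤ), evRow (y + B) z n r - (evRow y z n r + B * evRowD y z n r) ∈ J
  | _, [] => by simp [evRow, evRowD]
  | 0, c :: _ => by simp [evRow, evRowD]
  | n + 1, c :: cs => by
    have h := evRow_taylor y z B J hB n cs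
    have h2 := J.add_mem (J.mul_mem_left (y + B) h) (J.mul_mem_left (evRowD y z n cs) hB)
    simp only [evRow, evRowD]
    convert h2 using 1
    ring

theorem ev_taylor {R : Type*} [CommRing R] (x y z A B : R) (J : Ideal R) (hA : A * A ∈ J)
    (hAB : A * B ∈ J) (hB : B * B ∈ J) :
    ∀ (n : ℕ) (r : List (List ℤ)), ev (x + A) (y + B) z n r -
      (ev x y z n r + A * evDx x y z n r + B * evDy x y z n r) ∈ J
  | _, [] => by simp [ev, evDx, evDy]
  | 0, c :: _ => by
    simpa [ev, evDx, evDy, evRowD] using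
      (show evRow (y + B) z 0 c - evRow y z 0 c ∈ J by
        have := evRow_taylor y z B J hB 0 c
        cases c <;> simpa [evRowD] using this)
  | n + 1, c :: cs => by
    have h := ev_taylor x y z A B J hA hAB hB n cs
    have h0 := evRow_taylor y z B J hB (n + 1) c
    have h2 := J.add_mem (J.add_mem (J.add_mem h0 (J.mul_mem_left (x + A) h))
      (J.mul_mem_left (evDx x y z n cs) hA)) (J.mul_mem_left (evDy x y z n cs) hAB)
    simp only [ev, evDx, evDy]
    convert h2 using 1
    ring

theorem pol_mem_sq {p : Z3} {n : ℕ} {P : List (List ℤ)} (hc : p.2.2 ≠ 0)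
    (h0 : ev p.1 p.2.1 p.2.2 n P = 0) (hx : evDx p.1 p.2.1 p.2.2 n P = 0)
    (hy : evDy p.1 p.2.1 p.2.2 n P = 0) : pol n P ∈ Ip p ^ 2 := by
  set c : PolyR := (p.2.2 : PolyR) with hcdef
  set A : PolyR := c * X 0 - X 2 * (p.1 : PolyR) with hA
  set B : PolyR := c * X 1 - X 2 * (p.2.1 : PolyR) with hB
  have mA : A ∈ Ip p := by
    rw [Ip, mem_pi]; intro t; simp [hA, hcdef, rv]; ring
  have mB : B ∈ Ip p := by
    rw [Ip, mem_pi]; intro t; simp [hB, hcdef, rv]; ring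
  have hu : IsUnit (c ^ n) := (int_unit hc).pow n
  rw [← Ideal.unit_mul_mem_iff_mem _ hu, pol, ← ev_smul]
  have h := ev_taylor (X 2 * (p.1 : PolyR)) (X 2 * (p.2.1 : PolyR)) (X 2 * c) A B (Ip p ^ 2)
    (by rw [pow_two]; exact Ideal.mul_mem_mul mA mA)
    (by rw [pow_two]; exact Ideal.mul_mem_mul mA mB)
    (by rw [pow_two]; exact Ideal.mul_mem_mul mB mB) n P
  have X2 : (X 2 : PolyR) ≠ 0 := X_ne_zero 2
  have z0 : ev (X 2 * (p.1 : PolyR)) (X 2 * (p.2.1 : PolyR)) (X 2 * c) n P = 0 := by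
    have := map_ev (Int.castRingHom PolyR) p.1 p.2.1 p.2.2 n P
    simp only [eq_intCast, h0, Int.cast_zero] at this
    rw [ev_smul, ← this, mul_zero]
  have zx : evDx (X 2 * (p.1 : PolyR)) (X 2 * (p.2.1 : PolyR)) (X 2 * c) n P = 0 := by
    have := map_evDx (Int.castRingHom PolyR) p.1 p.2.1 p.2.2 n P
    simp only [eq_intCast, hx, Int.cast_zero] at this
    refine (mul_eq_zero.mp ?_).resolve_left X2
    rw [evDx_smul, ← this, mul_zero]
  have zy : evDy (X 2 * (p.1 : PolyR)) (X 2 * (p.2.1 : PolyR)) (X 2 * c) n P = 0 := by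
    have := map_evDy (Int.castRingHom PolyR) p.1 p.2.1 p.2.2 n P
    simp only [eq_intCast, hy, Int.cast_zero] at this
    refine (mul_eq_zero.mp ?_).resolve_left X2
    rw [evDy_smul, ← this, mul_zero]
  rw [z0, zx, zy] at h
  have e1 : X 2 * (p.1 : PolyR) + A = c * X 0 := by rw [hA]; ring
  have e2 : X 2 * (p.2.1 : PolyR) + B = c * X 1 := by rw [hB]; ring
  rw [e1, e2, mul_comm (X 2) c] at h
  simpa using h

theorem lines_mem (p : Z3) : ∀ ls : List Z3,
    prodG (ls.map lin) ∈ Ip p ^ (ls.countP fun l => dot l p == 0)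
  | [] => by simp
  | l :: ls => by
    have ih := lines_mem p ls
    have e : prodG ((l :: ls).map lin) = LP l * prodG (ls.map lin) := by
      simp [prodG, LP, lin]
    rw [e, List.countP_cons]
    by_cases h : dot l p = 0
    · simp only [h, beq_self_eq_true, if_true]
      rw [pow_succ', ]
      exact Ideal.mul_mem_mul (LP_mem.mpr h) ih
    · simp only [beq_iff_eq, h, if_false, add_zero]
      exact Ideal.mul_mem_left _ _ ih

def cnt (p : Z3) : ℕ := lines21.countP fun l => dot l p == 0

theorem ord_ok : ∀ p ∈ pts, 3 ≤ cnt p ∨ (2 ≤ cnt p ∧ evp p (12, hpol) = 0) ∨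
    (1 ≤ cnt p ∧ p.2.2 ≠ 0 ∧ ev p.1 p.2.1 p.2.2 12 hpol = 0 ∧ evDx p.1 p.2.1 p.2.2 12 hpol = 0 ∧
      evDy p.1 p.2.1 p.2.2 12 hpol = 0) := by
  decide +kernel

theorem FF_mem {p : Z3} (hp : p ∈ pts) : FF ∈ Ip p ^ 3 := by
  have e : FF = prodG (lines21.map lin) * pol 12 hpol := by simp [FF, prodG]
  have hl := lines_mem p lines21
  change _ ∈ Ip p ^ (cnt p) at hl
  rw [e]
  rcases ord_ok p hp with h | ⟨h, h1⟩ | ⟨h, h1, h2, h3, h4⟩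
  · exact Ideal.mul_mem_right _ _ (Ideal.pow_le_pow_right h hl)
  · have := Ideal.mul_mem_mul (Ideal.pow_le_pow_right h hl) (pol_mem h1)
    rwa [← pow_succ] at this
  · have := Ideal.mul_mem_mul (Ideal.pow_le_pow_right h hl) (pol_mem_sq h1 h2 h3 h4)
    rwa [← pow_add] at this
/-! ### the arrangement in integer coordinates -/

theorem u_sq : u * u = 3 / 4 := by
  unfold u
  have := Real.mul_self_sqrt (show (0 : ℝ) ≤ 3 by norm_num)
  linear_combination this / 4

theorem u_ne : u ≠ 0 := by
  intro h
  have := u_sq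
  rw [h] at this
  norm_num at this

theorem rot_inv : rotA⁻¹ = !![1/2, u, 0; -u, 1/2, 0; 0, 0, 1] := by
  apply Matrix.inv_eq_right_inv
  have := u_sq
  ext i j
  fin_cases i <;> fin_cases j <;> simp [rotA, Matrix.mul_apply, Fin.sum_univ_three] <;>
    linarith

theorem rot2_inv : (rotA ^ 2)⁻¹ = !![-1/2, u, 0; -u, -1/2, 0; 0, 0, 1] := by
  apply Matrix.inv_eq_right_inv
  have := u_sq
  have h2 : rotA ^ 2 = !![-1/2, -u, 0; u, -1/2, 0; 0, 0, 1] := by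
    rw [pow_two]
    ext i j
    fin_cases i <;> fin_cases j <;> simp [rotA, Matrix.mul_apply, Fin.sum_univ_three] <;>
      linarith
  rw [h2]
  ext i j
  fin_cases i <;> fin_cases j <;> simp [Matrix.mul_apply, Fin.sum_univ_three] <;>
    linarith

theorem eval_substMat (M : Matrix (Fin 3) (Fin 3) ℝ) (v : Fin 3 → ℝ) (f : PolyR) :
    eval v (substMat M f) = eval (fun i => ∑ j, M i j * v j) f := by
  have : (aeval v).comp (substMat M) = aeval (fun i => ∑ j, M i j * v j) := by
    ext i
    simp [substMat]
  have h := DFunLike.congr_fun this f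
  simpa [MvPolynomial.aeval_eq_eval] using h

def LL (i : Fin 31) : Z3 :=
  [(1, 0, 0), (1, 0, -1), (1, 0, 1), (1, 0, -2), (1, 0, 2), (1, 0, -4), (1, 0, 4), (0, 1, 0),
   (0, 1, -2), (0, 1, 2),
   (1, 1, 0), (1, 1, -2), (1, 1, 2), (1, 1, -4), (1, 1, 4), (1, 1, -8), (1, 1, 8), (-3, 1, 0),
   (-3, 1, -4), (-3, 1, 4),
   (-1, 1, 0), (-1, 1, -2), (-1, 1, 2), (-1, 1, -4), (-1, 1, 4), (-1, 1, -8), (-1, 1, 8),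
   (3, 1, 0), (3, 1, 4), (3, 1, -4), (0, 0, 1)].getD i (0, 0, 0)

def rdot (l : Z3) (w : Fin 3 → ℝ) : ℝ := l.1 * w 0 + l.2.1 * w 1 + l.2.2 * w 2

noncomputable def ww (v : Fin 3 → ℝ) : Fin 3 → ℝ := ![v 0 / u, 2 * v 1, v 2]

noncomputable def ss (v : Fin 3 → ℝ) : Fin 3 → ℝ := ![u * v 0, v 1 / 2, v 2]

theorem line_eval (i : Fin 31) : ∃ c : ℝ, c ≠ 0 ∧
    ∀ v r, r = rdot (LL i) (ww v) → eval v (lines313 i) = c * r := by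
  have hu := u_ne
  have h2 := u_sq
  have hx : ∀ a : ℝ, u * (a / u) = a := fun a => by field_simp
  have hx2 : ∀ a : ℝ, u * a = 3 / 4 * (a / u) := fun a => by
    field_simp; linear_combination (4 * a) * h2
  have A1 : u ≠ 0 := hu
  have A2 : (1 / 2 : ℝ) ≠ 0 := by norm_num
  have A3 : u / 2 ≠ 0 := by simpa using hu
  have A4 : (1 / 4 : ℝ) ≠ 0 := by norm_num
  have A5 : (-1 / 4 : ℝ) ≠ 0 := by norm_num
  have A6 : (1 : ℝ) ≠ 0 := by norm_num
  fin_cases i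
  iterate 7
    refine ⟨u, A1, fun v r hr => ?_⟩
    simp [LL, rdot, ww] at hr
    simp [lines313, baseForms313, eval_substMat, rot_inv, rot2_inv, Fin.sum_univ_three]
    linear_combination (-u) * hr + - hx (v 0)
  iterate 3
    refine ⟨(1 / 2), A2, fun v r hr => ?_⟩
    simp [LL, rdot, ww] at hr
    simp [lines313, baseForms313, eval_substMat, rot_inv, rot2_inv, Fin.sum_univ_three]
    linear_combination (-(1 / 2)) * hr
  iterate 7
    refine ⟨(u / 2), A3, fun v r hr => ?_⟩
    simp [LL, rdot, ww] at hr
    simp [lines313, baseForms313, eval_substMat, rot_inv, rot2_inv, Fin.sum_univ_three]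
    linear_combination (-(u / 2)) * hr + - hx (v 0) / 2
  iterate 3
    refine ⟨(1 / 4), A4, fun v r hr => ?_⟩
    simp [LL, rdot, ww] at hr
    simp [lines313, baseForms313, eval_substMat, rot_inv, rot2_inv, Fin.sum_univ_three]
    linear_combination (-(1 / 4)) * hr + - hx2 (v 0)
  iterate 7
    refine ⟨(u / 2), A3, fun v r hr => ?_⟩
    simp [LL, rdot, ww] at hr
    simp [lines313, baseForms313, eval_substMat, rot_inv, rot2_inv, Fin.sum_univ_three]
    linear_combination (-(u / 2)) * hr + hx (v 0) / 2
  iterate 3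
    refine ⟨(-1 / 4), A5, fun v r hr => ?_⟩
    simp [LL, rdot, ww] at hr
    simp [lines313, baseForms313, eval_substMat, rot_inv, rot2_inv, Fin.sum_univ_three]
    linear_combination (-(-1 / 4)) * hr + - hx2 (v 0)
  refine ⟨1, A6, fun v r hr => ?_⟩
  simp [LL, rdot, ww] at hr
  simp [lines313, hr]
theorem line_zero (i : Fin 31) (v : Fin 3 → ℝ) :
    eval v (lines313 i) = 0 ↔ rdot (LL i) (ww v) = 0 := by
  obtain ⟨c, hc, h⟩ := line_eval i
  rw [h v _ rfl]
  simp [hc]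

theorem ww_ss (v : Fin 3 → ℝ) : ww (ss v) = v := by
  have := u_ne
  ext i
  fin_cases i <;> simp [ww, ss] <;> field_simp

theorem ww_smul (c : ℝ) (v : Fin 3 → ℝ) : ww (c • v) = c • ww v := by
  ext i
  fin_cases i <;> simp [ww] <;> ring

theorem ss_smul (c : ℝ) (v : Fin 3 → ℝ) : ss (c • v) = c • ss v := by
  ext i
  fin_cases i <;> simp [ss] <;> ring

noncomputable def SS : PolyR →ₐ[ℝ] PolyR := aeval ![C (1 / u) * X 0, C 2 * X 1, X 2]

noncomputable def TT : PolyR →ₐ[ℝ] PolyR := aeval ![C u * X 0, C (1 / 2) * X 1, X 2]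

theorem eval_SS (v : Fin 3 → ℝ) (f : PolyR) : eval v (SS f) = eval (ww v) f := by
  have : (aeval v).comp SS = aeval (ww v) := by
    ext i
    fin_cases i <;> simp [SS, ww] <;> ring
  have h := DFunLike.congr_fun this f
  simpa [MvPolynomial.aeval_eq_eval] using h

theorem eval_TT (v : Fin 3 → ℝ) (f : PolyR) : eval v (TT f) = eval (ss v) f := by
  have : (aeval v).comp TT = aeval (ss v) := by
    ext i
    fin_cases i <;> simp [TT, ss] <;> ring
  have h := DFunLike.congr_fun this f
  simpa [MvPolynomial.aeval_eq_eval] using h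

theorem TT_SS (f : PolyR) : TT (SS f) = f := by
  apply MvPolynomial.funext
  intro v
  rw [eval_TT, eval_SS, ww_ss]

theorem pts_ok : ∀ p ∈ pts, dot p p ≠ 0 ∧ ∃ i j : Fin 31, i ≠ j ∧ dot (LL i) p = 0 ∧
    dot (LL j) p = 0 := by decide +kernel

theorem pairs_okB : ((List.finRange 31).all fun i => (List.finRange 31).all fun j =>
    (fun a b => i == j || pts.any fun p => dot a p == 0 && (dot b p == 0 &&
      (fun c => (!(dot c p == 0)) && crs p c == (0, 0, 0)) (crs a b))) (LL i) (LL j)) = true := by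
  decide +kernel

theorem pairs_ok : ∀ i j : Fin 31, i ≠ j → ∃ p ∈ pts, dot (crs (LL i) (LL j)) p ≠ 0 ∧
    crs p (crs (LL i) (LL j)) = (0, 0, 0) := by
  intro i j hij
  have h := pairs_okB
  simp only [List.all_eq_true] at h
  have h := h i (List.mem_finRange i) j (List.mem_finRange j)
  simp only [Bool.or_eq_true, beq_iff_eq, hij, false_or, List.any_eq_true, Bool.and_eq_true] at h
  obtain ⟨p, hp, _, _, h1, h2⟩ := h
  exact ⟨p, hp, by simpa using h1, h2⟩

theorem rdot_rv (l p : Z3) : rdot l (rv p) = (dot l p : ℤ) := by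
  simp [rdot, rv, dot]

theorem rv_ne {p : Z3} (h : dot p p ≠ 0) : rv p ≠ 0 := by
  intro h0
  apply h
  have : rdot p (rv p) = 0 := by rw [h0]; simp [rdot]
  rw [rdot_rv] at this
  exact_mod_cast this

theorem par {i j : Fin 31} (hij : i ≠ j) {w : Fin 3 → ℝ} (hw : w ≠ 0) (hi : rdot (LL i) w = 0)
    (hj : rdot (LL j) w = 0) : ∃ p ∈ pts, ∃ t : ℝ, t ≠ 0 ∧ w = t • rv p := by
  obtain ⟨p, hp, h1, h2⟩ := pairs_ok i j hij
  refine ⟨p, hp, ?_⟩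
  generalize hc : crs (LL i) (LL j) = c at h1 h2
  have c1 : (c.1 : ℝ) = (LL i).2.1 * (LL j).2.2 - (LL i).2.2 * (LL j).2.1 := by
    rw [← hc]; simp [crs]
  have c2 : (c.2.1 : ℝ) = (LL i).2.2 * (LL j).1 - (LL i).1 * (LL j).2.2 := by
    rw [← hc]; simp [crs]
  have c3 : (c.2.2 : ℝ) = (LL i).1 * (LL j).2.1 - (LL i).2.1 * (LL j).1 := by
    rw [← hc]; simp [crs]
  simp only [crs, Prod.mk.injEq] at h2
  obtain ⟨q1, q2, q3⟩ := h2
  have q1' : (p.2.1 : ℝ) * c.2.2 - p.2.2 * c.2.1 = 0 := by exact_mod_cast q1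
  have q2' : (p.2.2 : ℝ) * c.1 - p.1 * c.2.2 = 0 := by exact_mod_cast q2
  have q3' : (p.1 : ℝ) * c.2.1 - p.2.1 * c.1 = 0 := by exact_mod_cast q3
  have h1' : (c.1 : ℝ) * p.1 + c.2.1 * p.2.1 + c.2.2 * p.2.2 ≠ 0 := by
    have : ((dot c p : ℤ) : ℝ) ≠ 0 := by exact_mod_cast h1
    simpa [dot] using this
  simp only [rdot] at hi hj
  have r1 : w 1 * c.2.2 - w 2 * c.2.1 = 0 := by
    rw [c2, c3]; linear_combination (LL i).1 * hj - (LL j).1 * hi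
  have r2 : w 2 * c.1 - w 0 * c.2.2 = 0 := by
    rw [c1, c3]; linear_combination (LL i).2.1 * hj - (LL j).2.1 * hi
  have r3 : w 0 * c.2.1 - w 1 * c.1 = 0 := by
    rw [c1, c2]; linear_combination (LL i).2.2 * hj - (LL j).2.2 * hi
  have e : w = (rdot c w / (c.1 * p.1 + c.2.1 * p.2.1 + c.2.2 * p.2.2)) • rv p := by
    ext k
    simp only [Pi.smul_apply, smul_eq_mul, rdot]
    rw [div_mul_eq_mul_div, eq_div_iff h1']
    fin_cases k <;> simp [rv]
    · linear_combination p.2.1 * r3 - p.2.2 * r2 + w 2 * q2' - w 1 * q3'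
    · linear_combination p.2.2 * r1 - p.1 * r3 + w 0 * q3' - w 2 * q1'
    · linear_combination p.1 * r2 - p.2.1 * r1 + w 1 * q1' - w 0 * q2'
  refine ⟨_, ?_, e⟩
  intro h0
  rw [h0, zero_smul] at e
  exact hw e

theorem pt_in {p : Z3} (hp : p ∈ pts) : ∃ P ∈ S313, ∃ t : ℝ, t ≠ 0 ∧
    t • ss (rv p) = P.rep := by
  obtain ⟨h0, i, j, hij, hi, hj⟩ := pts_ok p hp
  have hne : ss (rv p) ≠ 0 := by
    intro h
    apply rv_ne h0
    rw [← ww_ss (rv p), h]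
    ext k; fin_cases k <;> simp [ww]
  obtain ⟨a, ha⟩ := Projectivization.exists_smul_eq_mk_rep ℝ (ss (rv p)) hne
  have ha' : (a : ℝ) • ss (rv p) = (Projectivization.mk ℝ (ss (rv p)) hne).rep := ha
  refine ⟨Projectivization.mk ℝ (ss (rv p)) hne, ?_, a, a.ne_zero, ha'⟩
  have key : ∀ i, dot (LL i) p = 0 →
      eval (Projectivization.mk ℝ (ss (rv p)) hne).rep (lines313 i) = 0 := by
    intro i hi
    rw [line_zero, ← ha', ww_smul, ww_ss]
    have := rdot_rv (LL i) p
    rw [hi] at this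
    simp only [rdot, Pi.smul_apply, smul_eq_mul, Int.cast_zero] at this ⊢
    linear_combination (a : ℝ) * this
  change 2 ≤ mult313 _
  unfold mult313
  apply Finset.one_lt_card.mpr
  exact ⟨i, by simp [key i hi], j, by simp [key j hj], hij⟩

theorem pt_out {P : P2R} (hP : P ∈ S313) : ∃ p ∈ pts, ∃ t : ℝ, t ≠ 0 ∧ ww P.rep = t • rv p := by
  change 2 ≤ mult313 _ at hP
  unfold mult313 at hP
  obtain ⟨i, hi, j, hj, hij⟩ := Finset.one_lt_card.mp hP
  simp only [Finset.mem_filter, Finset.mem_univ, true_and, line_zero] at hi hj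
  refine par hij ?_ hi hj
  intro h
  apply P.rep_nonzero
  have h0 := congrFun h 0
  have h1 := congrFun h 1
  have h2 := congrFun h 2
  simp [ww, u_ne] at h0 h1 h2
  ext k; fin_cases k <;> simp [h0, h1, h2]

theorem SS_FF_mem : SS FF ∈ ⨅ P ∈ S313, (pointIdeal (Projectivization.rep P)) ^ 3 := by
  simp only [Ideal.mem_iInf]
  intro P hP
  obtain ⟨p, hp, t, ht, hw⟩ := pt_out hP
  have h1 : Ideal.map SS (Ip p) ≤ pointIdeal P.rep := by
    rw [Ideal.map_le_iff_le_comap]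
    intro f hf
    rw [Ideal.mem_comap, mem_pi]
    intro c
    rw [eval_SS, ww_smul, hw, smul_smul]
    exact mem_pi.mp hf _
  have h2 := Ideal.mem_map_of_mem SS (FF_mem hp)
  rw [Ideal.map_pow] at h2
  exact Ideal.pow_right_mono h1 3 h2

theorem TT_I_le : Ideal.map TT (⨅ P ∈ S313, pointIdeal (Projectivization.rep P)) ≤ GS gens := by
  rw [Ideal.map_le_iff_le_comap]
  intro f hf
  rw [Ideal.mem_comap]
  apply I_le
  intro p hp
  obtain ⟨P, hP, t, ht, h⟩ := pt_in hp
  simp only [Ideal.mem_iInf] at hf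
  have h1 := hf P hP
  rw [← h, pi_smul ht] at h1
  rw [Ip, mem_pi]
  intro c
  rw [eval_TT, ss_smul]
  exact h1 c

/-- **Theorem A.** For the ideal `I` of the 127 intersection points of the simplicial
arrangement `A(31,3)` of 31 lines, the third symbolic power `I^(3) = ⋂_P I(P)³` is not
contained in `I²`. -/
theorem stmt0 :
    ¬ (⨅ P ∈ S313, (pointIdeal (Projectivization.rep P)) ^ 3) ≤
      (⨅ P ∈ S313, pointIdeal (Projectivization.rep P)) ^ 2 := by
  intro hle
  have h1 := Ideal.mem_map_of_mem TT (hle SS_FF_mem)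
  rw [TT_SS, Ideal.map_pow] at h1
  exact FF_not_mem (Ideal.pow_right_mono TT_I_le 2 h1)
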